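/- arXiv:2203.02137 — 2 statements merged into one kernel-verified Lean document; each statement's English description precedes it below -/
import Mathlib

section
/- Let n : ℕ and let D^n := Metric.closedBall (0 : EuclideanSpace ℝ (Fin n)) 1 be the closed unit ball, regarded as a topological space with the subspace topology. Let Cone(D^n) be the quotient of D^n × {t : ℝ // 0 ≤ t} by the relation identifying all points of D^n × {0} to a single point (and identifying nothing else). Then Cone(D^n) is homeomorphic to EuclideanSpace ℝ (Fin n) × {t : ℝ // 0 ≤ t}. -/
/-- The setoid on `A × ℝ_{≥0}` identifying all points of `A × {0}` to a single point
(and identifying nothing else); the quotient is the cone over `A`. -/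
def coneSetoid (A : Type*) : Setoid (A × {t : ℝ // 0 ≤ t}) where
  r p q := p = q ∨ ((p.2 : ℝ) = 0 ∧ (q.2 : ℝ) = 0)
  iseqv := by
    constructor
    · intro p; exact Or.inl rfl
    · intro p q h
      rcases h with h | ⟨h1, h2⟩
      · exact Or.inl h.symm
      · exact Or.inr ⟨h2, h1⟩
    · intro p q u h1 h2
      rcases h1 with rfl | ⟨a, b⟩
      · exact h2
      · rcases h2 with rfl | ⟨c, e⟩
        · exact Or.inr ⟨a, b⟩
        · exact Or.inr ⟨a, e⟩

/-- The cone over a topological space `A`, i.e. `(A × ℝ_{≥0}) / (A × {0})` with the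
quotient topology. -/
def Cone (A : Type*) [TopologicalSpace A] : Type _ := Quotient (coneSetoid A)

instance (A : Type*) [TopologicalSpace A] : TopologicalSpace (Cone A) :=
  instTopologicalSpaceQuotient

/-- The map `(x, t) ↦ (t x, t (1 - ‖x‖))` from the cylinder over the closed unit ball of `E`
to `E × ℝ_{≥0}`. -/
def coneClosedBallMap (E : Type*) [NormedAddCommGroup E] [NormedSpace ℝ E]
    (p : Metric.closedBall (0 : E) 1 × {t : ℝ // 0 ≤ t}) : E × {t : ℝ // 0 ≤ t} :=
  ((p.2 : ℝ) • (p.1 : E), ⟨p.2 * (1 - ‖(p.1 : E)‖),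
    mul_nonneg p.2.2 (sub_nonneg.2 (mem_closedBall_zero_iff.1 p.1.2))⟩)

section

variable {E : Type*} [NormedAddCommGroup E] [NormedSpace ℝ E]

lemma continuous_coneClosedBallMap : Continuous (coneClosedBallMap E) := by
  unfold coneClosedBallMap
  fun_prop

lemma norm_add_coneClosedBallMap (p : Metric.closedBall (0 : E) 1 × {t : ℝ // 0 ≤ t}) :
    ‖(coneClosedBallMap E p).1‖ + (coneClosedBallMap E p).2 = (p.2 : ℝ) := by
  simp only [coneClosedBallMap, norm_smul, Real.norm_of_nonneg p.2.2]
  ring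

lemma surjective_coneClosedBallMap : Function.Surjective (coneClosedBallMap E) := by
  rintro ⟨y, s, hs⟩
  have ht : 0 ≤ ‖y‖ + s := by positivity
  rcases ht.eq_or_lt with h0 | hpos
  · have hy : y = 0 := norm_eq_zero.1 (by linarith [norm_nonneg y])
    have hs0 : s = 0 := by linarith [norm_nonneg y]
    subst hy hs0
    exact ⟨(⟨0, by simp⟩, ⟨0, le_rfl⟩), by simp [coneClosedBallMap]⟩
  · have hn : ‖(‖y‖ + s)⁻¹ • y‖ = (‖y‖ + s)⁻¹ * ‖y‖ := by
      rw [norm_smul, Real.norm_of_nonneg (inv_nonneg.2 ht)]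
    refine ⟨(⟨(‖y‖ + s)⁻¹ • y, ?_⟩, ⟨‖y‖ + s, ht⟩), Prod.ext ?_ (Subtype.ext ?_)⟩
    · rw [mem_closedBall_zero_iff, hn, inv_mul_le_one₀ hpos]
      linarith
    · exact smul_inv_smul₀ hpos.ne' y
    · simp only [coneClosedBallMap, hn]
      field_simp
      ring

lemma ker_coneClosedBallMap :
    Setoid.ker (coneClosedBallMap E) = coneSetoid (Metric.closedBall (0 : E) 1) := by
  ext p q
  change coneClosedBallMap E p = coneClosedBallMap E q ↔ p = q ∨ ((p.2 : ℝ) = 0 ∧ (q.2 : ℝ) = 0)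
  constructor
  · intro h
    have ht : (p.2 : ℝ) = q.2 := by
      rw [← norm_add_coneClosedBallMap p, ← norm_add_coneClosedBallMap q, h]
    by_cases hq : (q.2 : ℝ) = 0
    · exact Or.inr ⟨ht.trans hq, hq⟩
    · have hx : (p.2 : ℝ) • (p.1 : E) = (q.2 : ℝ) • (q.1 : E) := congrArg Prod.fst h
      rw [ht] at hx
      exact Or.inl (Prod.ext (Subtype.ext (smul_right_injective E hq hx)) (Subtype.ext ht))
  · rintro (rfl | ⟨hp, hq⟩)
    · rfl
    · simp [coneClosedBallMap, hp, hq]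

lemma isProperMap_coneClosedBallMap [ProperSpace E] : IsProperMap (coneClosedBallMap E) := by
  have : CompactSpace (Metric.closedBall (0 : E) 1) :=
    isCompact_iff_compactSpace.1 (isCompact_closedBall 0 1)
  let g : E × {t : ℝ // 0 ≤ t} → {t : ℝ // 0 ≤ t} :=
    fun q ↦ ⟨‖q.1‖ + q.2, add_nonneg (norm_nonneg _) q.2.2⟩
  have hg : Continuous g := by fun_prop
  have hcomp : g ∘ coneClosedBallMap E = Prod.snd :=
    funext fun p ↦ Subtype.ext (norm_add_coneClosedBallMap p)
  exact isProperMap_of_comp_of_t2 continuous_coneClosedBallMap hg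
    (hcomp ▸ isProperMap_snd_of_compactSpace)

/-- The cone over the closed unit ball of a proper real normed space `E` is homeomorphic
to `E × ℝ_{≥0}`. -/
noncomputable def coneClosedBallHomeomorph [ProperSpace E] :
    Cone (Metric.closedBall (0 : E) 1) ≃ₜ E × {t : ℝ // 0 ≤ t} :=
  (Homeomorph.Quotient.congrRight fun p q ↦ by rw [← ker_coneClosedBallMap]).trans
    (Topology.IsQuotientMap.homeomorph
      (f := ⟨coneClosedBallMap E, continuous_coneClosedBallMap⟩)
      (isProperMap_coneClosedBallMap.isClosedMap.isQuotientMap continuous_coneClosedBallMap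
        surjective_coneClosedBallMap))

end

/-- `Cone(Dⁿ) ≅ ℝⁿ × ℝ_{≥0}`: the cone over the closed unit ball in `ℝⁿ` is homeomorphic
to `ℝⁿ × ℝ_{≥0}`. -/
theorem cone_closedBall_homeomorph (n : ℕ) :
    Nonempty (Cone (Metric.closedBall (0 : EuclideanSpace ℝ (Fin n)) 1) ≃ₜ
      (EuclideanSpace ℝ (Fin n) × {t : ℝ // 0 ≤ t})) := by
  exact ⟨coneClosedBallHomeomorph⟩
end

section
/- Let (W, S) be a Coxeter system with length function ℓ and Bruhat order ≤, and let J ⊆ S. For w ∈ W write w = w_J · ^Jw for the unique factorization with w_J ∈ W_J, ^Jw ∈ ^JW and ℓ(w) = ℓ(w_J) + ℓ(^Jw); define the J-twisted length ^Jℓ(w) := ℓ(^Jw) − ℓ(w_J) (an integer), and define the J-twisted Bruhat order by: w' ^J≤ w iff there exists u ∈ W_J with w_J ≤ w'_J · u⁻¹ and u · ^Jw' ≤ ^Jw. Then: (1) ^J≤ is a partial order on W; (2) for all v, w with v ^J≤ w, every maximal chain in the closed interval [v, w] of (W, ^J≤) has length ^Jℓ(w) − ^Jℓ(v) (so the interval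 is graded); (3) every closed interval of (W, ^J≤) is thin, i.e., every subinterval of rank 2 contains exactly four elements; (4) every closed interval of (W, ^J≤) is shellable. -/
section PosetCombinatorics

variable {α : Type*} (r : α → α → Prop)

/-- A chain of the subposet `s` with respect to the relation `r`. -/
def ChainIn (s c : Set α) : Prop := c ⊆ s ∧ IsChain r c

/-- A maximal chain of the subposet `s` with respect to the relation `r`. -/
def MaxChainIn (s c : Set α) : Prop :=
  ChainIn r s c ∧ ∀ c' : Set α, ChainIn r s c' → c ⊆ c' → c = c'

/-- The closed interval `[a, b]` inside the subposet `s`. -/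
def intervalIn (s : Set α) (a b : α) : Set α := {x ∈ s | r a x ∧ r x b}

/-- The subposet `s` is graded: all its maximal chains have the same cardinality. -/
def GradedIn (s : Set α) : Prop := ∃ n : ℕ, ∀ c : Set α, MaxChainIn r s c → c.ncard = n

/-- The subposet `s` is thin: every closed interval of rank 2 (i.e. in which all maximal
chains have 3 elements) contains exactly four elements. -/
def ThinIn (s : Set α) : Prop :=
  ∀ a ∈ s, ∀ b ∈ s, r a b →
    (∀ c : Set α, MaxChainIn r (intervalIn r s a b) c → c.ncard = 3) →
      (intervalIn r s a b).ncard = 4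

/-- The subposet `s` is shellable: its maximal chains can be enumerated `c_1, …, c_t`
such that for all `i < j` there exists `k < j` with `c_i ∩ c_j ⊆ c_k ∩ c_j` and
`|c_k ∩ c_j| = |c_j| − 1`. -/
def ShellableIn (s : Set α) : Prop :=
  ∃ (t : ℕ) (c : Fin t → Set α), Function.Injective c ∧
    (∀ i, MaxChainIn r s (c i)) ∧ (∀ d : Set α, MaxChainIn r s d → ∃ i, d = c i) ∧
    ∀ i j : Fin t, i < j → ∃ k : Fin t, k < j ∧
      c i ∩ c j ⊆ c k ∩ c j ∧ (c k ∩ c j).ncard = (c j).ncard - 1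

end PosetCombinatorics

section Coxeter

variable {B : Type*} {M : CoxeterMatrix B} {W : Type*} [Group W]

/-- The Bruhat order on a Coxeter group: `v ≤ w` iff some reduced word for `w` contains
a subword that is a reduced word for `v`. -/
def bruhatLE (cs : CoxeterSystem M W) (v w : W) : Prop :=
  ∃ ω : List B, cs.IsReduced ω ∧ cs.wordProd ω = w ∧
    ∃ ω' : List B, ω'.Sublist ω ∧ cs.IsReduced ω' ∧ cs.wordProd ω' = v

/-- The `J`-twisted Bruhat order on `W`: given the parabolic factorization data
`w = wJ w * Jw w` (with `wJ w ∈ W_J` and `Jw w ∈ ᴶW`), we set `w' ᴶ≤ w` iff there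
exists `u ∈ W_J` with `wJ w ≤ wJ w' * u⁻¹` and `u * Jw w' ≤ Jw w` in Bruhat order. -/
def twistedLE (cs : CoxeterSystem M W) (J : Set B) (wJ Jw : W → W) (w' w : W) : Prop :=
  ∃ u ∈ Subgroup.closure (cs.simple '' J),
    bruhatLE cs (wJ w) (wJ w' * u⁻¹) ∧ bruhatLE cs (u * Jw w') (Jw w)

end Coxeter

namespace CoxeterMatrix

variable {B : Type*} (M : CoxeterMatrix B)

/-- The entry of the standard Cartan matrix attached to `M`. -/
noncomputable def cartan (i j : B) : ℝ := -2 * Real.cos (Real.pi / M i j)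

theorem cartan_self (i : B) : M.cartan i i = 2 := by simp [cartan]

theorem cartan_comm (i j : B) : M.cartan i j = M.cartan j i := by
  simp [cartan, M.symmetric i j]

/-- The simple coroot on the root space extended by one coordinate, on which every simple coroot
takes the value `1`. -/
noncomputable def simpleCoroot (i : B) : Module.Dual ℝ ((B →₀ ℝ) × ℝ) :=
  (Finsupp.linearCombination ℝ (M.cartan i)).comp (LinearMap.fst ℝ _ _) + LinearMap.snd ℝ _ _

/-- The simple root, as an element of the extended root space. -/
noncomputable def simpleRoot (i : B) : (B →₀ ℝ) × ℝ := (Finsupp.single i 1, 0)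

theorem simpleCoroot_simpleRoot (i j : B) :
    M.simpleCoroot i (simpleRoot j) = M.cartan i j := by
  simp [simpleCoroot, simpleRoot]

theorem simpleCoroot_self (i : B) : M.simpleCoroot i (simpleRoot i) = 2 := by
  rw [simpleCoroot_simpleRoot, cartan_self]

theorem reflection_mul_reflection_pow_eq_one {V : Type*} [AddCommGroup V] [Module ℝ V] {x y : V}
    {f g : Module.Dual ℝ V} (hf : f x = 2) (hg : g y = 2) {m : ℕ} (hm2 : m ≠ 1)
    (hfy : f y = -2 * Real.cos (Real.pi / m)) (hgx : g x = -2 * Real.cos (Real.pi / m)) :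
    (Module.reflection hf * Module.reflection hg) ^ m = 1 := by
  obtain rfl | rfl | h3 : m = 0 ∨ m = 2 ∨ 3 ≤ m := by omega
  · rw [pow_zero]
  · have hk : Real.cos (Real.pi / (2 : ℕ)) = 0 := by simp
    rw [hk, mul_zero] at hfy hgx
    rw [pow_two]
    ext1 z
    simp only [LinearEquiv.mul_apply, Module.reflection_apply, map_sub, map_smul, hf, hg, hfy, hgx,
      LinearEquiv.coe_one, id]
    module
  · set θ : ℝ := Real.pi / m with hθ
    have hm : (3 : ℝ) ≤ m := by exact_mod_cast h3
    have hmθ : m * θ = Real.pi := by rw [hθ]; field_simp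
    have hs : Real.sin (2 * θ) ≠ 0 := by
      have hpos := Real.pi_pos
      have h1 : 0 < θ := by positivity
      apply (Real.sin_pos_of_pos_of_lt_pi (by positivity) _).ne'
      nlinarith
    ext1 z
    rw [Module.reflection_mul_reflection_pow_apply]
    have ht : f y * g x - 2 = 2 * Real.cos (2 * θ) := by
      rw [hfy, hgx, Real.cos_two_mul]; ring
    rw [ht]
    have hS (n : ℤ) : (Polynomial.Chebyshev.S ℝ n).eval (2 * Real.cos (2 * θ)) =
        Real.sin ((n + 1) * (2 * θ)) / Real.sin (2 * θ) := by
      rw [eq_div_iff hs, Polynomial.Chebyshev.S_two_mul_real_cos]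
    obtain ⟨k, hk | hk⟩ := Nat.even_or_odd' m
    · have e1 : ((m : ℤ) - 2) / 2 = k - 1 := by omega
      have e2 : ((m : ℤ) - 1) / 2 = k - 1 := by omega
      have e3 : (Polynomial.Chebyshev.S ℝ (k - 1)).eval (2 * Real.cos (2 * θ)) = 0 := by
        rw [hS]
        have : (((k - 1 : ℤ) : ℝ) + 1) * (2 * θ) = Real.pi := by
          rw [← hmθ, hk]; push_cast; ring
        rw [this]; simp
      rw [e1, e2, e3]
      simp
    · have e1 : ((m : ℤ) - 2) / 2 = k - 1 := by omega
      have e2 : ((m : ℤ) - 1) / 2 = k := by omega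
      have e4 : (m : ℤ) / 2 = k := by omega
      have e3 : ((m : ℤ) - 3) / 2 = k - 1 := by omega
      have e5 : (Polynomial.Chebyshev.S ℝ k).eval (2 * Real.cos (2 * θ)) +
          (Polynomial.Chebyshev.S ℝ (k - 1)).eval (2 * Real.cos (2 * θ)) = 0 := by
        rw [hS, hS, ← add_div]
        have h1 : (((k : ℤ) : ℝ) + 1) * (2 * θ) = Real.pi + θ := by
          rw [← hmθ, hk]; push_cast; ring
        have h2 : (((k - 1 : ℤ) : ℝ) + 1) * (2 * θ) = Real.pi - θ := by
          rw [← hmθ, hk]; push_cast; ring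
        rw [h1, h2, Real.sin_pi_sub, add_comm Real.pi, Real.sin_add_pi]; simp
      rw [e1, e2, e3, e4, e5]
      simp

theorem isLiftable_reflection :
    M.IsLiftable (fun i => Module.reflection (M.simpleCoroot_self i)) := by
  intro i j
  rcases eq_or_ne i j with rfl | hij
  · rw [M.diagonal, pow_one]
    ext1 z
    simp only [LinearEquiv.mul_apply, Module.reflection_apply, map_sub, map_smul,
      simpleCoroot_self, LinearEquiv.coe_one, id]
    module
  · exact reflection_mul_reflection_pow_eq_one _ _ (M.off_diagonal i j hij)
      (M.simpleCoroot_simpleRoot i j)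
      ((M.simpleCoroot_simpleRoot j i).trans (M.cartan_comm j i))

end CoxeterMatrix

namespace CoxeterSystem

open CoxeterMatrix

variable {B : Type*} {M : CoxeterMatrix B} {W : Type*} [Group W] (cs : CoxeterSystem M W)

/-- The geometric representation on the extended root space. -/
noncomputable def geomRep : W →* (((B →₀ ℝ) × ℝ) ≃ₗ[ℝ] ((B →₀ ℝ) × ℝ)) :=
  cs.lift ⟨_, M.isLiftable_reflection⟩

theorem geomRep_simple (i : B) (z : (B →₀ ℝ) × ℝ) :
    cs.geomRep (cs.simple i) z = z - M.simpleCoroot i z • simpleRoot i := by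
  rw [geomRep, lift_apply_simple, Module.reflection_apply]

theorem geomRep_mul (v w : W) (z : (B →₀ ℝ) × ℝ) :
    cs.geomRep (v * w) z = cs.geomRep v (cs.geomRep w z) := by
  rw [map_mul]; rfl

theorem geomRep_one (z : (B →₀ ℝ) × ℝ) : cs.geomRep 1 z = z := by
  rw [map_one]; rfl

theorem geomRep_inv_apply (w : W) (z : (B →₀ ℝ) × ℝ) :
    cs.geomRep w⁻¹ (cs.geomRep w z) = z := by
  rw [← geomRep_mul, inv_mul_cancel, geomRep_one]

theorem geomRep_apply_inv (w : W) (z : (B →₀ ℝ) × ℝ) :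
    cs.geomRep w (cs.geomRep w⁻¹ z) = z := by
  rw [← geomRep_mul, mul_inv_cancel, geomRep_one]

theorem geomRep_simple_self (i : B) :
    cs.geomRep (cs.simple i) (simpleRoot i) = -simpleRoot i := by
  rw [geomRep_simple, simpleCoroot_self]; module

theorem geomRep_mul_simple_self (w : W) (i : B) :
    cs.geomRep (w * cs.simple i) (simpleRoot i) = -cs.geomRep w (simpleRoot i) := by
  rw [geomRep_mul, geomRep_simple_self, map_neg]

theorem geomRep_snd (w : W) (z : (B →₀ ℝ) × ℝ) : (cs.geomRep w z).2 = z.2 := by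
  induction w using cs.simple_induction_left generalizing z with
  | one => rw [geomRep_one]
  | mul_simple_left w i ih => rw [geomRep_mul, geomRep_simple]; simp [ih, simpleRoot]

end CoxeterSystem

namespace CoxeterSystem

open CoxeterMatrix

variable {B : Type*} {M : CoxeterMatrix B} {W : Type*} [Group W] (cs : CoxeterSystem M W)

/-- A vector all of whose coordinates along the simple roots are nonnegative. -/
def IsPos (z : (B →₀ ℝ) × ℝ) : Prop := ∀ k, 0 ≤ z.1 k

theorem isPos_simpleRoot (i : B) : IsPos (simpleRoot i) := fun k => by
  classical
  simp only [simpleRoot, Finsupp.single_apply]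
  split_ifs <;> norm_num

theorem IsPos.add {y z : (B →₀ ℝ) × ℝ} (hy : IsPos y) (hz : IsPos z) : IsPos (y + z) :=
  fun k => add_nonneg (hy k) (hz k)

theorem IsPos.smul {z : (B →₀ ℝ) × ℝ} (hz : IsPos z) {c : ℝ} (hc : 0 ≤ c) : IsPos (c • z) :=
  fun k => mul_nonneg hc (hz k)

/-- The coefficients of the roots of a dihedral root system. -/
noncomputable def dihedralCoeff (M : CoxeterMatrix B) (i j : B) (k : ℕ) : ℝ :=
  (Polynomial.Chebyshev.S ℝ (k - 1)).eval (-M.cartan i j)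

theorem dihedralCoeff_nonneg {i j : B} (hij : i ≠ j) {k : ℕ} (hk : M i j ≠ 0 → k ≤ M i j) :
    0 ≤ dihedralCoeff M i j k := by
  have hc : -M.cartan i j = 2 * Real.cos (Real.pi / M i j) := by simp [cartan]
  rw [dihedralCoeff, hc]
  by_cases h0 : M i j = 0
  · simp [h0]
  · have h2 : 2 ≤ M i j := by
      have := M.off_diagonal i j hij
      omega
    have hm : (2 : ℝ) ≤ M i j := by exact_mod_cast h2
    have hk' : (k : ℝ) ≤ M i j := by exact_mod_cast hk h0
    have hpi := Real.pi_pos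
    have hs : 0 < Real.sin (Real.pi / M i j) := by
      apply Real.sin_pos_of_pos_of_lt_pi (by positivity)
      rw [div_lt_iff₀ (by positivity)]
      nlinarith
    have h := Polynomial.Chebyshev.S_two_mul_real_cos (Real.pi / M i j) (k - 1)
    have h3 : 0 ≤ Real.sin ((((k - 1 : ℤ) : ℝ) + 1) * (Real.pi / M i j)) := by
      push_cast
      rw [sub_add_cancel]
      apply Real.sin_nonneg_of_nonneg_of_le_pi (by positivity)
      rw [← mul_div_assoc, div_le_iff₀ (by positivity)]
      nlinarith
    rw [← h] at h3
    exact nonneg_of_mul_nonneg_left h3 hs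

theorem dihedralCoeff_add_two (i j : B) (k : ℕ) :
    dihedralCoeff M i j (k + 2) =
      -M.cartan i j * dihedralCoeff M i j (k + 1) - dihedralCoeff M i j k := by
  have h := Polynomial.Chebyshev.S_add_two ℝ ((k : ℤ) - 1)
  simp only [dihedralCoeff]
  rw [show ((k + 2 : ℕ) : ℤ) - 1 = (k : ℤ) - 1 + 2 by push_cast; ring,
    show ((k + 1 : ℕ) : ℤ) - 1 = (k : ℤ) - 1 + 1 by push_cast; ring, h]
  simp

theorem geomRep_alternatingWord (i j : B) (k : ℕ) :
    cs.geomRep (cs.wordProd (alternatingWord i j k)) (simpleRoot i) =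
      if Even k then
        dihedralCoeff M i j (k + 1) • simpleRoot i + dihedralCoeff M i j k • simpleRoot j
      else
        dihedralCoeff M i j k • simpleRoot i + dihedralCoeff M i j (k + 1) • simpleRoot j := by
  induction k with
  | zero => simp [alternatingWord, dihedralCoeff]
  | succ k ih =>
    rw [alternatingWord_succ', wordProd_cons, geomRep_mul, ih, dihedralCoeff_add_two]
    have hji := M.cartan_comm j i
    by_cases hk : Even k
    · have hk1 : ¬ Even (k + 1) := by simpa [Nat.even_add_one] using hk
      simp only [hk, hk1, if_true, if_false, geomRep_simple, map_add, map_smul,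
        simpleCoroot_simpleRoot, M.cartan_self, hji]
      module
    · have hk1 : Even (k + 1) := by simpa [Nat.even_add_one] using hk
      simp only [hk, hk1, if_true, if_false, geomRep_simple, map_add, map_smul,
        simpleCoroot_simpleRoot, M.cartan_self]
      module

theorem exists_maximal_alternating_suffix {w : W} {i j : B}
    (hj : cs.length (w * cs.simple j) < cs.length w) :
    ∃ (k : ℕ) (v : W), 0 < k ∧ w = v * cs.wordProd (alternatingWord i j k) ∧
      cs.length w = cs.length v + k ∧ cs.length v < cs.length (v * cs.simple i) ∧
      cs.length v < cs.length (v * cs.simple j) := by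
  classical
  let P : ℕ → Prop := fun k => ∃ v : W, w = v * cs.wordProd (alternatingWord i j k) ∧
    cs.length w = cs.length v + k
  have hb : ∀ k, P k → k ≤ cs.length w := fun k ⟨v, _, hv⟩ => by omega
  have h1 : P 1 := ⟨w * cs.simple j, by simp [alternatingWord], by
    have := cs.length_mul_simple w j
    omega⟩
  have hk := Nat.findGreatest_spec (hb 1 h1) h1
  have hk1 : 1 ≤ Nat.findGreatest P (cs.length w) := Nat.le_findGreatest (hb 1 h1) h1
  have hmax : ∀ k, P k → k ≤ Nat.findGreatest P (cs.length w) :=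
    fun k h => Nat.le_findGreatest (hb k h) h
  set k := Nat.findGreatest P (cs.length w)
  obtain ⟨v, hv, hlv⟩ := hk
  have hA : cs.length v < cs.length (v * cs.simple (if Even k then j else i)) := by
    by_contra hlt
    set c := if Even k then j else i with hc
    have hne := cs.length_mul_simple v c
    have : P (k + 1) := by
      refine ⟨v * cs.simple c, ?_, by omega⟩
      rw [alternatingWord_succ', wordProd_cons, ← hc, hv]
      simp [← mul_assoc]
    have := hmax _ this
    omega
  have hB : cs.length v < cs.length (v * cs.simple (if Even k then i else j)) := by
    obtain ⟨n, hn⟩ : ∃ n, k = n + 1 := ⟨k - 1, by omega⟩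
    have hcc : (if Even k then i else j) = if Even n then j else i := by
      rw [hn]; by_cases he : Even n <;> simp [he, Nat.even_add_one]
    rw [hcc]
    set c := if Even n then j else i with hc
    rw [hn, alternatingWord_succ', wordProd_cons, ← hc, ← mul_assoc] at hv
    have h3 := cs.length_mul_le (v * cs.simple c) (cs.wordProd (alternatingWord i j n))
    have h4 := cs.length_wordProd_le (alternatingWord i j n)
    rw [length_alternatingWord] at h4
    rw [← hv] at h3
    omega
  refine ⟨k, v, hk1, hv, hlv, ?_⟩
  by_cases he : Even k
  · simp only [he, if_true] at hA hB
    exact ⟨hB, hA⟩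
  · simp only [he, if_false] at hA hB
    exact ⟨hA, hB⟩

theorem isPos_geomRep_simpleRoot {w : W} {i : B}
    (hi : cs.length w < cs.length (w * cs.simple i)) :
    IsPos (cs.geomRep w (simpleRoot i)) := by
  induction hn : cs.length w using Nat.strong_induction_on generalizing w i with
  | _ n ih =>
    by_cases hw : w = 1
    · rw [hw, geomRep_one]; exact isPos_simpleRoot i
    obtain ⟨j, hj⟩ := cs.exists_rightDescent_of_ne_one hw
    have hij : i ≠ j := by
      rintro rfl
      exact absurd hj (by unfold IsRightDescent; omega)
    obtain ⟨k, v, hk0, hv, hlv, hvi, hvj⟩ := cs.exists_maximal_alternating_suffix (i := i) hj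
    have hpi := ih _ (by omega) hvi rfl
    have hpj := ih _ (by omega) hvj rfl
    have hkm : M i j ≠ 0 → k + 1 ≤ M i j := by
      intro hm
      by_contra hlt
      rcases Nat.lt_or_ge (M i j) k with h | h
      · apply cs.not_isReduced_alternatingWord i j hm h
        have h1 := cs.length_mul_le v (cs.wordProd (alternatingWord i j k))
        have h2 := cs.length_wordProd_le (alternatingWord i j k)
        rw [← hv] at h1
        rw [IsReduced]
        rw [length_alternatingWord] at h2 ⊢
        omega
      · have hkm : k = M i j := by omega
        obtain ⟨n, hn⟩ : ∃ n, k = n + 1 := ⟨k - 1, by omega⟩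
        have hbr : cs.wordProd (alternatingWord i j k) = cs.wordProd (alternatingWord j i k) := by
          have := cs.wordProd_braidWord_eq i j
          rwa [braidWord, braidWord, M.symmetric j i, ← hkm] at this
        rw [hbr, hn, alternatingWord_succ, wordProd_concat, ← mul_assoc] at hv
        have h1 := cs.length_mul_le v (cs.wordProd (alternatingWord i j n))
        have h2 := cs.length_wordProd_le (alternatingWord i j n)
        rw [length_alternatingWord] at h2
        rw [hv, simple_mul_simple_cancel_right, ← hv] at hi
        omega
    have c1 : 0 ≤ dihedralCoeff M i j k := dihedralCoeff_nonneg hij (fun h => by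
      have := hkm h
      omega)
    have c2 : 0 ≤ dihedralCoeff M i j (k + 1) := dihedralCoeff_nonneg hij hkm
    rw [hv, geomRep_mul, geomRep_alternatingWord]
    split_ifs
    · simp only [map_add, map_smul]
      exact (hpi.smul c2).add (hpj.smul c1)
    · simp only [map_add, map_smul]
      exact (hpi.smul c1).add (hpj.smul c2)

theorem isPos_neg_geomRep_simpleRoot {w : W} {i : B}
    (hi : cs.length (w * cs.simple i) < cs.length w) :
    IsPos (-cs.geomRep w (simpleRoot i)) := by
  rw [← geomRep_mul_simple_self]
  exact cs.isPos_geomRep_simpleRoot (by simpa using hi)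

end CoxeterSystem

namespace CoxeterSystem

open CoxeterMatrix

variable {B : Type*} {M : CoxeterMatrix B} {W : Type*} [Group W] (cs : CoxeterSystem M W)

theorem geomRep_simpleRoot_ne_zero (w : W) (i : B) : cs.geomRep w (simpleRoot i) ≠ 0 := by
  rw [Ne, LinearEquiv.map_eq_zero_iff]
  intro h
  have := congrArg (fun z : (B →₀ ℝ) × ℝ => z.1 i) h
  simp [simpleRoot] at this

theorem geomRep_conj_simple (w : W) (i : B) (z : (B →₀ ℝ) × ℝ) :
    cs.geomRep (w * cs.simple i * w⁻¹) z =
      z - M.simpleCoroot i (cs.geomRep w⁻¹ z) • cs.geomRep w (simpleRoot i) := by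
  rw [geomRep_mul, geomRep_mul, geomRep_simple, map_sub, map_smul, geomRep_apply_inv]

theorem eq_one_of_forall_not_isPos_neg {x : W}
    (h : ∀ k, ¬ IsPos (-cs.geomRep x (simpleRoot k))) : x = 1 := by
  by_contra hx
  obtain ⟨k, hk⟩ := cs.exists_rightDescent_of_ne_one hx
  exact h k (cs.isPos_neg_geomRep_simpleRoot hk)

/-- A reflection is determined by the line spanned by its root. -/
theorem conj_simple_eq_simple {w : W} {i j : B} {c : ℝ} (hc : c ≠ 0)
    (h : cs.geomRep w (simpleRoot j) = c • simpleRoot i) :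
    w * cs.simple j * w⁻¹ = cs.simple i := by
  classical
  have key : cs.simple i * (w * cs.simple j * w⁻¹) = 1 := by
    apply cs.eq_one_of_forall_not_isPos_neg
    intro k hk
    rcases eq_or_ne k i with rfl | hki
    · have h1 : cs.geomRep (w * cs.simple j * w⁻¹) (simpleRoot k) = -simpleRoot k := by
        have h2 : simpleRoot k = c⁻¹ • cs.geomRep w (simpleRoot j) := by
          rw [h, smul_smul, inv_mul_cancel₀ hc, one_smul]
        rw [h2, map_smul, geomRep_mul, geomRep_inv_apply, geomRep_mul_simple_self, smul_neg]
      have := hk k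
      rw [geomRep_mul, h1, map_neg, geomRep_simple_self, neg_neg] at this
      simp [simpleRoot] at this
      linarith
    · have := hk k
      rw [geomRep_mul, geomRep_conj_simple, h, geomRep_simple] at this
      simp [simpleRoot, hki.symm] at this
      linarith
  rw [eq_comm, ← inv_simple]
  exact inv_eq_of_mul_eq_one_right key

/-- Positive root, coroot and a presentation of the reflection `t`. -/
theorem exists_root_data {t : W} (ht : cs.IsReflection t) :
    ∃ p : W × B, t = p.1 * cs.simple p.2 * p.1⁻¹ ∧
      cs.length p.1 < cs.length (p.1 * cs.simple p.2) := by
  obtain ⟨w, i, h⟩ := ht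
  rcases lt_or_gt_of_ne (cs.length_mul_simple_ne w i) with hlt | hgt
  · refine ⟨(w * cs.simple i, i), ?_, by simpa using hlt⟩
    simp [h, mul_assoc]
  · exact ⟨(w, i), h, hgt⟩

open Classical in
/-- The positive root of a reflection (and `0` for other elements). -/
noncomputable def root (t : W) : (B →₀ ℝ) × ℝ :=
  if ht : cs.IsReflection t then
    cs.geomRep (cs.exists_root_data ht).choose.1 (simpleRoot (cs.exists_root_data ht).choose.2)
  else 0

open Classical in
/-- The coroot of a reflection (and `0` for other elements). -/
noncomputable def coroot (t : W) : Module.Dual ℝ ((B →₀ ℝ) × ℝ) :=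
  if ht : cs.IsReflection t then
    (M.simpleCoroot (cs.exists_root_data ht).choose.2).comp
      (cs.geomRep (cs.exists_root_data ht).choose.1⁻¹).toLinearMap
  else 0

theorem root_spec {t : W} (ht : cs.IsReflection t) :
    ∃ (w : W) (i : B), t = w * cs.simple i * w⁻¹ ∧ cs.length w < cs.length (w * cs.simple i) ∧
      cs.root t = cs.geomRep w (simpleRoot i) ∧
      ∀ z, cs.coroot t z = M.simpleCoroot i (cs.geomRep w⁻¹ z) := by
  have h := (cs.exists_root_data ht).choose_spec
  refine ⟨_, _, h.1, h.2, ?_, fun z => ?_⟩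
  · rw [root, dif_pos ht]
  · rw [coroot, dif_pos ht]; rfl

theorem isPos_root {t : W} (ht : cs.IsReflection t) : IsPos (cs.root t) := by
  obtain ⟨w, i, -, h, hr, -⟩ := cs.root_spec ht
  exact hr ▸ cs.isPos_geomRep_simpleRoot h

theorem root_ne_zero {t : W} (ht : cs.IsReflection t) : cs.root t ≠ 0 := by
  obtain ⟨w, i, -, -, hr, -⟩ := cs.root_spec ht
  exact hr ▸ cs.geomRep_simpleRoot_ne_zero w i

theorem root_snd {t : W} (ht : cs.IsReflection t) : (cs.root t).2 = 0 := by
  obtain ⟨w, i, -, -, hr, -⟩ := cs.root_spec ht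
  rw [hr, geomRep_snd]; rfl

theorem geomRep_reflection {t : W} (ht : cs.IsReflection t) (z : (B →₀ ℝ) × ℝ) :
    cs.geomRep t z = z - cs.coroot t z • cs.root t := by
  obtain ⟨w, i, h, -, hr, hc⟩ := cs.root_spec ht
  rw [hc, hr, ← geomRep_conj_simple, ← h]

theorem coroot_root {t : W} (ht : cs.IsReflection t) : cs.coroot t (cs.root t) = 2 := by
  obtain ⟨w, i, -, -, hr, hc⟩ := cs.root_spec ht
  rw [hc, hr, geomRep_inv_apply, simpleCoroot_self]

theorem geomRep_root_self {t : W} (ht : cs.IsReflection t) :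
    cs.geomRep t (cs.root t) = -cs.root t := by
  rw [geomRep_reflection _ ht, coroot_root _ ht]; module

theorem exists_coeff_pos {t : W} (ht : cs.IsReflection t) : ∃ k, 0 < (cs.root t).1 k := by
  by_contra! h
  apply cs.root_ne_zero ht
  refine Prod.ext (Finsupp.ext fun k => ?_) (cs.root_snd ht)
  exact le_antisymm (h k) (cs.isPos_root ht k)

theorem isPos_smul_root {t : W} (ht : cs.IsReflection t) {c : ℝ} :
    IsPos (c • cs.root t) ↔ 0 ≤ c := by
  refine ⟨fun h => ?_, (cs.isPos_root ht).smul⟩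
  obtain ⟨k, hk⟩ := cs.exists_coeff_pos ht
  have : 0 ≤ c * (cs.root t).1 k := h k
  exact nonneg_of_mul_nonneg_left this hk

theorem eq_smul_root_of_neg {t : W} (ht : cs.IsReflection t) {z : (B →₀ ℝ) × ℝ}
    (hz : cs.geomRep t z = -z) : z = (cs.coroot t z / 2) • cs.root t := by
  rw [geomRep_reflection _ ht] at hz
  have h2 : (2 : ℝ) • z = cs.coroot t z • cs.root t := by
    have h3 : (2 : ℝ) • z = (z - cs.coroot t z • cs.root t) + z + cs.coroot t z • cs.root t := by
      module
    rw [h3, hz, neg_add_cancel, zero_add]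
  rw [div_eq_inv_mul, ← smul_smul, ← h2, smul_smul]
  norm_num

theorem exists_geomRep_root (x : W) {t : W} (ht : cs.IsReflection t) :
    ∃ c : ℝ, c ≠ 0 ∧ cs.geomRep x (cs.root t) = c • cs.root (x * t * x⁻¹) := by
  have h : cs.geomRep (x * t * x⁻¹) (cs.geomRep x (cs.root t)) = -cs.geomRep x (cs.root t) := by
    rw [← geomRep_mul, inv_mul_cancel_right, geomRep_mul, geomRep_root_self _ ht, map_neg]
  have h2 := cs.eq_smul_root_of_neg (ht.conj x) h
  refine ⟨_, fun h0 => ?_, h2⟩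
  rw [h0, zero_smul, LinearEquiv.map_eq_zero_iff] at h2
  exact cs.root_ne_zero ht h2

theorem eq_of_root_eq_smul {t r : W} (ht : cs.IsReflection t) (hr : cs.IsReflection r) {c : ℝ}
    (h : cs.root t = c • cs.root r) : t = r := by
  obtain ⟨w, i, h1, -, h2, -⟩ := cs.root_spec ht
  obtain ⟨v, j, h3, -, h4, -⟩ := cs.root_spec hr
  have hc : c ≠ 0 := by
    rintro rfl
    exact cs.root_ne_zero ht (by simpa using h)
  have h5 : cs.geomRep (v⁻¹ * w) (simpleRoot i) = c • simpleRoot j := by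
    rw [geomRep_mul, ← h2, h, h4, map_smul, geomRep_inv_apply]
  have h6 := cs.conj_simple_eq_simple hc h5
  rw [h1, h3, ← h6]
  group

theorem root_simple (i : B) : ∃ c : ℝ, 0 < c ∧ cs.root (cs.simple i) = c • simpleRoot i := by
  have hs := cs.isReflection_simple i
  have h := cs.eq_smul_root_of_neg hs (cs.geomRep_simple_self i)
  set c := cs.coroot (cs.simple i) (simpleRoot i) / 2
  have hc0 : c ≠ 0 := by
    intro h0
    rw [h0, zero_smul] at h
    exact cs.geomRep_simpleRoot_ne_zero 1 i (by rw [h, map_zero])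
  have hc : 0 ≤ c := by
    rw [← cs.isPos_smul_root hs, ← h]
    exact isPos_simpleRoot i
  refine ⟨c⁻¹, inv_pos.2 (lt_of_le_of_ne hc hc0.symm), ?_⟩
  conv_rhs => rw [h]
  rw [smul_smul, inv_mul_cancel₀ hc0, one_smul]

theorem isPos_or_isPos_neg (w : W) {t : W} (ht : cs.IsReflection t) :
    IsPos (cs.geomRep w (cs.root t)) ∨ IsPos (-cs.geomRep w (cs.root t)) := by
  obtain ⟨c, -, h⟩ := cs.exists_geomRep_root w ht
  have h3 : -(c • cs.root (w * t * w⁻¹)) = (-c) • cs.root (w * t * w⁻¹) := by module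
  rw [h, h3, isPos_smul_root _ (ht.conj w), isPos_smul_root _ (ht.conj w)]
  rcases le_total 0 c with h | h
  · exact Or.inl h
  · exact Or.inr (by linarith)

theorem not_isPos_and_isPos_neg (w : W) {t : W} (ht : cs.IsReflection t) :
    ¬ (IsPos (cs.geomRep w (cs.root t)) ∧ IsPos (-cs.geomRep w (cs.root t))) := by
  obtain ⟨c, hc, h⟩ := cs.exists_geomRep_root w ht
  have h3 : -(c • cs.root (w * t * w⁻¹)) = (-c) • cs.root (w * t * w⁻¹) := by module
  rw [h, h3, isPos_smul_root _ (ht.conj w), isPos_smul_root _ (ht.conj w)]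
  rintro ⟨h1, h2⟩
  exact hc (by linarith)

theorem isPos_neg_iff (w : W) {t : W} (ht : cs.IsReflection t) :
    IsPos (-cs.geomRep w (cs.root t)) ↔ ¬ IsPos (cs.geomRep w (cs.root t)) := by
  have h1 := cs.isPos_or_isPos_neg w ht
  have h2 := cs.not_isPos_and_isPos_neg w ht
  tauto

/-- A simple reflection permutes the positive roots other than its own, up to scaling. -/
theorem exists_pos_geomRep_simple_root (i : B) {t : W} (ht : cs.IsReflection t)
    (hti : t ≠ cs.simple i) :
    ∃ c : ℝ, 0 < c ∧ cs.geomRep (cs.simple i) (cs.root t) =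
      c • cs.root (cs.simple i * t * (cs.simple i)⁻¹) := by
  obtain ⟨c, hc, h⟩ := cs.exists_geomRep_root (cs.simple i) ht
  refine ⟨c, ?_, h⟩
  by_contra hneg
  have hlt : c < 0 := lt_of_le_of_ne (not_lt.1 hneg) hc
  apply hti
  have hz : cs.root t = ((cs.root t).1 i) • simpleRoot i := by
    refine Prod.ext (Finsupp.ext fun k => ?_) (by simp [root_snd _ ht, simpleRoot])
    rcases eq_or_ne k i with rfl | hk
    · simp [simpleRoot]
    · have h1 := congrArg (fun z : (B →₀ ℝ) × ℝ => z.1 k) h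
      rw [geomRep_simple] at h1
      simp [simpleRoot, hk.symm] at h1
      have h2 := cs.isPos_root ht k
      have h3 : 0 ≤ (cs.root (cs.simple i * t * cs.simple i)).1 k := by
        have := cs.isPos_root (ht.conj (cs.simple i)) k
        rwa [inv_simple] at this
      have h4 : (cs.root t).1 k = 0 := le_antisymm (by nlinarith) h2
      simp [h4, simpleRoot, hk.symm]
  obtain ⟨d, hd, hs⟩ := cs.root_simple i
  apply cs.eq_of_root_eq_smul ht (cs.isReflection_simple i) (c := (cs.root t).1 i * d⁻¹)
  rw [hs, smul_smul, mul_assoc, inv_mul_cancel₀ hd.ne', mul_one, ← hz]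

theorem isPos_smul_iff {c : ℝ} (hc : 0 < c) (z : (B →₀ ℝ) × ℝ) : IsPos (c • z) ↔ IsPos z := by
  refine ⟨fun h => ?_, fun h => h.smul hc.le⟩
  have := h.smul (inv_pos.2 hc).le
  rwa [smul_smul, inv_mul_cancel₀ hc.ne', one_smul] at this

/-- The strong exchange property, in terms of roots. -/
theorem exists_eraseIdx_of_not_isPos (ω : List B) {t : W} (ht : cs.IsReflection t)
    (h : ¬ IsPos (cs.geomRep (cs.wordProd ω)⁻¹ (cs.root t))) :
    ∃ k < ω.length, t * cs.wordProd ω = cs.wordProd (ω.eraseIdx k) := by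
  induction ω generalizing t with
  | nil => exact absurd (by simpa using cs.isPos_root ht) h
  | cons i ω ih =>
    by_cases hti : t = cs.simple i
    · refine ⟨0, by simp, ?_⟩
      simp [hti, wordProd_cons]
    · obtain ⟨c, hc, hs⟩ := cs.exists_pos_geomRep_simple_root i ht hti
      rw [wordProd_cons, mul_inv_rev, geomRep_mul, inv_simple, hs, map_smul,
        isPos_smul_iff hc] at h
      obtain ⟨k, hk, hk2⟩ := ih (ht.conj (cs.simple i)) h
      refine ⟨k + 1, by simpa using hk, ?_⟩
      rw [List.eraseIdx_cons_succ, wordProd_cons, wordProd_cons, ← hk2]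
      simp [mul_assoc]

theorem length_mul_lt_iff_not_isPos {t : W} (ht : cs.IsReflection t) (x : W) :
    cs.length (t * x) < cs.length x ↔ ¬ IsPos (cs.geomRep x⁻¹ (cs.root t)) := by
  have key : ∀ x : W, ¬ IsPos (cs.geomRep x⁻¹ (cs.root t)) →
      cs.length (t * x) < cs.length x := by
    intro x h
    obtain ⟨ω, hω, rfl⟩ := cs.exists_isReduced x
    obtain ⟨k, hk, h2⟩ := cs.exists_eraseIdx_of_not_isPos ω ht h
    rw [h2, hω.eq]
    have := cs.length_wordProd_le (ω.eraseIdx k)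
    rw [List.length_eraseIdx_of_lt hk] at this
    omega
  refine ⟨fun h hp => ?_, key x⟩
  have h1 := key (t * x) (by
    rw [mul_inv_rev, geomRep_mul, ht.inv, geomRep_root_self _ ht, map_neg,
      cs.isPos_neg_iff _ ht, not_not]
    exact hp)
  rw [← mul_assoc, ht.mul_self, one_mul] at h1
  omega

end CoxeterSystem

namespace CoxeterSystem

open CoxeterMatrix

variable {B : Type*} {M : CoxeterMatrix B} {W : Type*} [Group W] (cs : CoxeterSystem M W)

/-- Left multiplication by `t` shortens `x`. -/
def Shortens (t x : W) : Prop := cs.length (t * x) < cs.length x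

variable {cs} in
theorem IsReflection.shortens_mul_self {t : W} (ht : cs.IsReflection t) (x : W) :
    cs.Shortens t (t * x) ↔ ¬ cs.Shortens t x := by
  have := ht.length_mul_right_ne x
  rw [Shortens, Shortens, ← mul_assoc, ht.mul_self, one_mul]
  omega

theorem shortens_iff {t : W} (ht : cs.IsReflection t) (x : W) :
    cs.Shortens t x ↔ ¬ IsPos (cs.geomRep x⁻¹ (cs.root t)) :=
  cs.length_mul_lt_iff_not_isPos ht x

theorem Shortens.exists_eraseIdx {cs : CoxeterSystem M W} {ω : List B} {t : W}
    (ht : cs.IsReflection t) (h : cs.Shortens t (cs.wordProd ω)) :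
    ∃ k < ω.length, t * cs.wordProd ω = cs.wordProd (ω.eraseIdx k) :=
  cs.exists_eraseIdx_of_not_isPos ω ht ((cs.shortens_iff ht _).1 h)

theorem shortens_mul_simple_iff {t : W} (ht : cs.IsReflection t) {x : W} {i : B}
    (h : t ≠ x * cs.simple i * x⁻¹) : cs.Shortens t (x * cs.simple i) ↔ cs.Shortens t x := by
  rw [shortens_iff _ ht, shortens_iff _ ht, not_iff_not]
  obtain ⟨c, hc, h1⟩ := cs.exists_geomRep_root x⁻¹ ht
  have hr := ht.conj x⁻¹
  have hne : x⁻¹ * t * x⁻¹⁻¹ ≠ cs.simple i := by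
    intro h2
    apply h
    rw [← h2]; group
  obtain ⟨d, hd, h2⟩ := cs.exists_pos_geomRep_simple_root i hr hne
  rw [mul_inv_rev, geomRep_mul, inv_simple, h1, map_smul, h2, smul_comm, isPos_smul_iff hd,
    isPos_smul_root _ hr, isPos_smul_root _ (hr.conj _)]

theorem shortens_conj_simple_iff (x : W) (i : B) :
    cs.Shortens (x * cs.simple i * x⁻¹) x ↔ cs.length (x * cs.simple i) < cs.length x := by
  rw [Shortens, inv_mul_cancel_right]

/-- The displacement of the fundamental covector under `x`. -/
noncomputable def displacement (x : W) : (B →₀ ℝ) × ℝ := (0, 1) - cs.geomRep x (0, 1)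

theorem simpleCoroot_zero_one (i : B) : M.simpleCoroot i (0, 1) = 1 := by
  simp [simpleCoroot]

theorem displacement_one : cs.displacement 1 = 0 := by
  rw [displacement, geomRep_one, sub_self]

theorem displacement_mul_simple (y : W) (i : B) :
    cs.displacement (y * cs.simple i) = cs.displacement y + cs.geomRep y (simpleRoot i) := by
  rw [displacement, geomRep_mul, geomRep_simple, simpleCoroot_zero_one, displacement, one_smul,
    map_sub]
  abel

theorem isPos_displacement (x : W) : IsPos (cs.displacement x) := by
  induction hn : cs.length x using Nat.strong_induction_on generalizing x with
  | _ n ih =>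
    by_cases hx : x = 1
    · rw [hx, displacement_one]; exact fun k => le_rfl
    obtain ⟨i, hi⟩ := cs.exists_rightDescent_of_ne_one hx
    have h := cs.displacement_mul_simple (x * cs.simple i) i
    rw [simple_mul_simple_cancel_right] at h
    rw [h]
    exact (ih _ (hn ▸ hi) _ rfl).add (cs.isPos_geomRep_simpleRoot (by
      rw [simple_mul_simple_cancel_right]; exact hi))

theorem displacement_ne_zero {x : W} (hx : x ≠ 1) : cs.displacement x ≠ 0 := by
  obtain ⟨i, hi⟩ := cs.exists_rightDescent_of_ne_one hx
  have h := cs.displacement_mul_simple (x * cs.simple i) i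
  rw [simple_mul_simple_cancel_right] at h
  have h1 := cs.isPos_displacement (x * cs.simple i)
  have h2 := cs.isPos_geomRep_simpleRoot (w := x * cs.simple i) (i := i) (by
    rw [simple_mul_simple_cancel_right]; exact hi)
  intro h0
  apply cs.geomRep_simpleRoot_ne_zero (x * cs.simple i) i
  refine Prod.ext (Finsupp.ext fun k => ?_) (by rw [geomRep_snd]; rfl)
  have h3 := congrArg (fun z : (B →₀ ℝ) × ℝ => z.1 k) (h.symm.trans h0)
  simp only [Prod.fst_add, Finsupp.add_apply, Prod.fst_zero, Finsupp.zero_apply] at h3 ⊢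
  have := h1 k
  have := h2 k
  linarith

theorem coroot_geomRep_ne_zero {t : W} (ht : cs.IsReflection t) (x : W) :
    cs.coroot t (cs.geomRep x (0, 1)) ≠ 0 ∧
      (0 < cs.coroot t (cs.geomRep x (0, 1)) ↔ ¬ cs.Shortens t x) := by
  have h1 : cs.displacement (x⁻¹ * t * x) =
      cs.coroot t (cs.geomRep x (0, 1)) • cs.geomRep x⁻¹ (cs.root t) := by
    rw [displacement, geomRep_mul, geomRep_mul, geomRep_reflection _ ht, map_sub, map_smul,
      geomRep_inv_apply]
    abel
  have hne : x⁻¹ * t * x ≠ 1 := by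
    intro h
    have h2 : t = 1 := by
      have : t = x * (x⁻¹ * t * x) * x⁻¹ := by group
      rw [this, h]; group
    have := ht.odd_length
    rw [h2, length_one] at this
    exact absurd this (by decide)
  have h3 := cs.displacement_ne_zero hne
  have h4 := cs.isPos_displacement (x⁻¹ * t * x)
  rw [h1] at h3 h4
  have h5 : cs.coroot t (cs.geomRep x (0, 1)) ≠ 0 := fun h => h3 (by rw [h, zero_smul])
  refine ⟨h5, ?_⟩
  rw [shortens_iff _ ht, not_not]
  obtain ⟨c, hc, h6⟩ := cs.exists_geomRep_root x⁻¹ ht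
  rw [h6] at h4 ⊢
  rw [smul_smul, isPos_smul_root _ (ht.conj _)] at h4
  rw [isPos_smul_root _ (ht.conj _)]
  constructor
  · intro h; exact nonneg_of_mul_nonneg_right h4 h
  · intro h
    have : 0 < c := lt_of_le_of_ne h hc.symm
    exact lt_of_le_of_ne (nonneg_of_mul_nonneg_left h4 this) h5.symm

theorem displacement_reflection_mul {t : W} (ht : cs.IsReflection t) (x : W) :
    cs.displacement (t * x) =
      cs.displacement x + cs.coroot t (cs.geomRep x (0, 1)) • cs.root t := by
  rw [displacement, geomRep_mul, geomRep_reflection _ ht, displacement]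
  abel

/-! ### Standard parabolic subgroups -/

/-- The standard parabolic subgroup generated by `J`. -/
abbrev parabolic (J : Set B) : Subgroup W := Subgroup.closure (cs.simple '' J)

variable {cs} {J : Set B}

theorem simple_mem_parabolic {j : B} (hj : j ∈ J) : cs.simple j ∈ cs.parabolic J :=
  Subgroup.subset_closure ⟨j, hj, rfl⟩

theorem geomRep_coeff_of_mem_parabolic {x : W} (hx : x ∈ cs.parabolic J) {k : B} (hk : k ∉ J)
    (z : (B →₀ ℝ) × ℝ) : (cs.geomRep x z).1 k = z.1 k := by
  classical
  induction hx using Subgroup.closure_induction generalizing z with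
  | mem x hx =>
    obtain ⟨j, hj, rfl⟩ := hx
    have hjk : j ≠ k := by rintro rfl; exact hk hj
    rw [geomRep_simple]
    simp [simpleRoot, hjk]
  | one => rw [geomRep_one]
  | mul x y _ _ hx hy => rw [geomRep_mul, hx, hy]
  | inv x _ hx => rw [← hx, geomRep_apply_inv]

theorem mem_parabolic_of_coeff {x : W}
    (h : ∀ i, ∀ k ∉ J, (cs.geomRep x (simpleRoot i)).1 k = (simpleRoot i).1 k) :
    x ∈ cs.parabolic J := by
  induction hn : cs.length x using Nat.strong_induction_on generalizing x with
  | _ n ih =>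
    by_cases hx : x = 1
    · rw [hx]; exact one_mem _
    obtain ⟨i, hi⟩ := cs.exists_rightDescent_of_ne_one hx
    have hiJ : i ∈ J := by
      by_contra hiJ
      have h1 := cs.isPos_neg_geomRep_simpleRoot hi i
      have h2 := h i i hiJ
      simp only [Prod.fst_neg, Finsupp.neg_apply, h2] at h1
      simp [simpleRoot] at h1
      linarith
    have h3 : x * cs.simple i ∈ cs.parabolic J := by
      refine ih _ (hn ▸ hi) (fun j k hk => ?_) rfl
      rw [geomRep_mul, geomRep_simple, map_sub, map_smul]
      simp only [Prod.fst_sub, Finsupp.sub_apply, Prod.smul_fst, Finsupp.smul_apply, h _ k hk]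
      have hik : i ≠ k := by rintro rfl; exact hk hiJ
      simp [simpleRoot, hik]
    have := mul_mem h3 (simple_mem_parabolic hiJ)
    rwa [simple_mul_simple_cancel_right] at this

theorem reflection_mem_parabolic_iff {t : W} (ht : cs.IsReflection t) :
    t ∈ cs.parabolic J ↔ ∀ k ∉ J, (cs.root t).1 k = 0 := by
  constructor
  · intro h k hk
    have := geomRep_coeff_of_mem_parabolic h hk (cs.root t)
    rw [geomRep_root_self _ ht] at this
    simp only [Prod.fst_neg, Finsupp.neg_apply] at this
    linarith
  · intro h
    apply mem_parabolic_of_coeff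
    intro i k hk
    rw [geomRep_reflection _ ht]
    simp [h k hk]

theorem mem_of_simple_mem_parabolic {i : B} (h : cs.simple i ∈ cs.parabolic J) : i ∈ J := by
  by_contra hi
  have h1 := (reflection_mem_parabolic_iff (cs.isReflection_simple i)).1 h i hi
  obtain ⟨c, hc, h2⟩ := cs.root_simple i
  rw [h2] at h1
  simp [simpleRoot] at h1
  exact hc.ne' h1

theorem exists_word_of_mem_parabolic {x : W} (hx : x ∈ cs.parabolic J) :
    ∃ ω : List B, (∀ j ∈ ω, j ∈ J) ∧ cs.wordProd ω = x := by
  induction hx using Subgroup.closure_induction with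
  | mem x hx =>
    obtain ⟨j, hj, rfl⟩ := hx
    exact ⟨[j], by simpa using hj, by simp⟩
  | one => exact ⟨[], by simp, by simp⟩
  | mul x y _ _ hx hy =>
    obtain ⟨ω, h1, rfl⟩ := hx
    obtain ⟨ω', h2, rfl⟩ := hy
    refine ⟨ω ++ ω', fun j hj => ?_, cs.wordProd_append _ _⟩
    rcases List.mem_append.1 hj with h | h
    exacts [h1 j h, h2 j h]
  | inv x _ hx =>
    obtain ⟨ω, h1, rfl⟩ := hx
    exact ⟨ω.reverse, by simpa using h1, cs.wordProd_reverse ω⟩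

theorem wordProd_mem_parabolic {ω : List B} (h : ∀ j ∈ ω, j ∈ J) :
    cs.wordProd ω ∈ cs.parabolic J := by
  refine Subgroup.list_prod_mem _ fun x hx => ?_
  obtain ⟨j, hj, rfl⟩ := List.mem_map.1 hx
  exact simple_mem_parabolic (h j hj)

theorem Shortens.mem_parabolic {t a : W} (ht : cs.IsReflection t) (h : cs.Shortens t a)
    (ha : a ∈ cs.parabolic J) : t ∈ cs.parabolic J := by
  obtain ⟨ω, hω, rfl⟩ := exists_word_of_mem_parabolic ha
  obtain ⟨k, -, hk⟩ := h.exists_eraseIdx ht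
  have h1 : t * cs.wordProd ω ∈ cs.parabolic J := by
    rw [hk]
    exact wordProd_mem_parabolic fun j hj => hω j (List.mem_of_mem_eraseIdx hj)
  exact (Subgroup.mul_mem_cancel_right _ ha).1 h1

theorem mem_of_rightDescent_of_mem_parabolic {a : W} (ha : a ∈ cs.parabolic J) {i : B}
    (h : cs.length (a * cs.simple i) < cs.length a) : i ∈ J := by
  have h1 := Shortens.mem_parabolic ((cs.isReflection_simple i).conj a)
    ((cs.shortens_conj_simple_iff a i).2 h) ha
  apply mem_of_simple_mem_parabolic (cs := cs)
  have := mul_mem (mul_mem (inv_mem ha) h1) ha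
  convert this using 1
  group

end CoxeterSystem

namespace CoxeterSystem

open CoxeterMatrix

variable {B : Type*} {M : CoxeterMatrix B} {W : Type*} [Group W] (cs : CoxeterSystem M W)

section LexPos

variable [LinearOrder B]

/-- The first nonzero coefficient is positive. -/
def LexPos (v : B →₀ ℝ) : Prop := ∃ i, (∀ j < i, v j = 0) ∧ 0 < v i

theorem LexPos.add {u v : B →₀ ℝ} (hu : LexPos u) (hv : LexPos v) : LexPos (u + v) := by
  obtain ⟨i, hi, hi'⟩ := hu
  obtain ⟨j, hj, hj'⟩ := hv
  rcases lt_trichotomy i j with h | rfl | h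
  · exact ⟨i, fun k hk => by simp [hi k hk, hj k (hk.trans h)], by simpa [hj i h] using hi'⟩
  · exact ⟨i, fun k hk => by simp [hi k hk, hj k hk], by simpa using add_pos hi' hj'⟩
  · exact ⟨j, fun k hk => by simp [hj k hk, hi k (hk.trans h)], by simpa [hi j h] using hj'⟩

theorem lexPos_smul_iff {u : B →₀ ℝ} {c : ℝ} (hc : 0 < c) : LexPos (c • u) ↔ LexPos u := by
  simp [LexPos, hc, hc.ne']

theorem LexPos.not_neg {u : B →₀ ℝ} (hu : LexPos u) : ¬ LexPos (-u) := by
  intro h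
  obtain ⟨i, -, hi⟩ := hu.add h
  simp at hi

theorem lexPos_sub_iff {u v : B →₀ ℝ} : LexPos (v - u) ↔ toLex u < toLex v := by
  rw [Finsupp.Lex.lt_iff, LexPos]
  simp only [Finsupp.sub_apply, sub_pos, sub_eq_zero]
  simp only [eq_comm]
  rfl

theorem lexPos_neg_or_of_ne_zero {u : B →₀ ℝ} (hu : u ≠ 0) : LexPos u ∨ LexPos (-u) := by
  rcases lt_or_gt_of_ne (fun h => hu (toLex.injective h) : toLex u ≠ toLex 0) with h | h
  · exact Or.inr (by simpa using lexPos_sub_iff.2 h)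
  · exact Or.inl (by simpa using lexPos_sub_iff.2 h)

end LexPos

/-- The sum of the coefficients. -/
noncomputable def rootHeight : ((B →₀ ℝ) × ℝ) →ₗ[ℝ] ℝ :=
  (Finsupp.linearCombination ℝ (fun _ : B => (1 : ℝ))).comp (LinearMap.fst ℝ _ _)

variable {cs} in
theorem IsReflection.rootHeight_pos {t : W} (ht : cs.IsReflection t) :
    0 < rootHeight (cs.root t) := by
  obtain ⟨k, hk⟩ := cs.exists_coeff_pos ht
  simp only [rootHeight, LinearMap.comp_apply, LinearMap.fst_apply,
    Finsupp.linearCombination_apply, Finsupp.sum, smul_eq_mul, mul_one]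
  exact Finset.sum_pos' (fun i _ => cs.isPos_root ht i)
    ⟨k, Finsupp.mem_support_iff.2 hk.ne', hk⟩

/-- The root of `t`, scaled to have height one. -/
noncomputable def normRoot (t : W) : B →₀ ℝ := (rootHeight (cs.root t))⁻¹ • (cs.root t).1

theorem normRoot_injOn : Set.InjOn cs.normRoot {t | cs.IsReflection t} := by
  intro t ht r hr h
  have h1 := ht.rootHeight_pos
  have h2 := hr.rootHeight_pos
  apply cs.eq_of_root_eq_smul ht hr
    (c := rootHeight (cs.root t) * (rootHeight (cs.root r))⁻¹)
  refine Prod.ext ?_ (by simp [root_snd _ ht, root_snd _ hr])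
  rw [Prod.smul_fst, mul_smul, ← normRoot, ← h, normRoot, smul_smul, mul_inv_cancel₀ h1.ne',
    one_smul]

/-- The linear map recording the position of a vector relative to the root of `t`. -/
noncomputable def slope (t : W) : ((B →₀ ℝ) × ℝ) →ₗ[ℝ] (B →₀ ℝ) :=
  LinearMap.fst ℝ _ _ - rootHeight.smulRight (cs.normRoot t)

theorem slope_root (t : W) {r : W} (hr : cs.IsReflection r) :
    cs.slope t (cs.root r) = rootHeight (cs.root r) • (cs.normRoot r - cs.normRoot t) := by
  have h : rootHeight (cs.root r) • cs.normRoot r = (cs.root r).1 := by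
    rw [normRoot, smul_smul, mul_inv_cancel₀ hr.rootHeight_pos.ne', one_smul]
  rw [smul_sub, h]
  rfl

open Classical in
/-- The sign attached to a reflection by the parabolic subgroup of type `J`. -/
noncomputable def parabolicSign (J : Set B) (t : W) : ℝ := if t ∈ cs.parabolic J then -1 else 1

/-- The root of `t`, negated if `t` belongs to the parabolic subgroup of type `J`. -/
noncomputable def twistedRoot (J : Set B) (t : W) : (B →₀ ℝ) × ℝ :=
  cs.parabolicSign J t • cs.root t

theorem normRoot_lt_of_mem_parabolic [LinearOrder B] {J : Set B}
    (hJ : ∀ i, i ∉ J → ∀ j ∈ J, i < j) {r t : W} (hr : cs.IsReflection r)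
    (ht : cs.IsReflection t) (hrJ : r ∈ cs.parabolic J) (htJ : t ∉ cs.parabolic J) :
    LexPos (cs.normRoot t - cs.normRoot r) := by
  have hr0 : ∀ k ∉ J, cs.normRoot r k = 0 := fun k hk => by
    simp [normRoot, (reflection_mem_parabolic_iff hr).1 hrJ k hk]
  have hne : cs.normRoot t - cs.normRoot r ≠ 0 := fun h => htJ (by
    rwa [cs.normRoot_injOn ht hr (sub_eq_zero.1 h)])
  refine (lexPos_neg_or_of_ne_zero hne).resolve_right fun ⟨i, hi, hi'⟩ => ?_
  rw [reflection_mem_parabolic_iff ht] at htJ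
  push Not at htJ
  obtain ⟨k, hk, hk'⟩ := htJ
  have h1 := inv_pos.2 ht.rootHeight_pos
  by_cases hiJ : i ∈ J
  · have := hi k (hJ k hk i hiJ)
    simp [hr0 k hk] at this
    simp [normRoot, hk', ht.rootHeight_pos.ne'] at this
  · have h2 := cs.isPos_root ht i
    have h3 : 0 ≤ cs.normRoot t i := mul_nonneg h1.le h2
    simp [hr0 i hiJ] at hi'
    linarith

/-- The defining properties of the reflection orders used below: an order on the reflections for
which, after moving the reflections of the parabolic subgroup to the end, every root separates
the smaller twisted roots from the larger ones. -/
structure IsTwistedReflectionOrder (J : Set B) [LinearOrder W] : Prop where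
  /-- The compatibility with conjugation. -/
  shortens_iff : ∀ r t, cs.IsReflection r → cs.IsReflection t → r ≠ t →
    (cs.Shortens r t ↔ ¬ ((r ∈ cs.parabolic J ↔ r < t) ↔
      (t * r * t ∈ cs.parabolic J ↔ t * r * t < t)))
  /-- The convexity property. -/
  not_comb : ∀ r t p q, cs.IsReflection r → cs.IsReflection t → cs.IsReflection p →
    cs.IsReflection q → r < t → t < p → t < q → ∀ a b c d : ℝ, 0 < a → 0 < b → 0 < c → 0 < d →
    a • cs.twistedRoot J t + b • cs.twistedRoot J r ≠
      c • cs.twistedRoot J p + d • cs.twistedRoot J q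

theorem parabolicSign_cases (J : Set B) (t : W) :
    (t ∈ cs.parabolic J ∧ cs.parabolicSign J t = -1) ∨
      (t ∉ cs.parabolic J ∧ cs.parabolicSign J t = 1) := by
  by_cases h : t ∈ cs.parabolic J <;> simp [parabolicSign, h]

theorem exists_linearOrder_lt_of_mem (J : Set B) :
    ∃ L : LinearOrder B, ∀ i, i ∉ J → ∀ j ∈ J, L.lt i j := by
  classical
  let k : B → Bool ×ₗ Cardinal := fun b => toLex (decide (b ∈ J), embeddingToCardinal b)
  refine ⟨LinearOrder.lift' k
    (fun a b h => embeddingToCardinal.injective (Prod.ext_iff.1 h).2), fun i hi j hj => ?_⟩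
  change k i < k j
  simp [k, Prod.Lex.toLex_lt_toLex, hi, hj]

theorem exists_linearOrder_normRoot [LinearOrder B] (J : Set B) :
    ∃ L : LinearOrder W, ∀ r t, cs.IsReflection r → cs.IsReflection t → r ≠ t → (L.lt r t ↔
      (r ∉ cs.parabolic J ∧ t ∈ cs.parabolic J) ∨
      ((r ∈ cs.parabolic J ↔ t ∈ cs.parabolic J) ∧
        LexPos (cs.normRoot t - cs.normRoot r))) := by
  classical
  let k : W → Bool ×ₗ Lex (B →₀ ℝ) ×ₗ Cardinal := fun t =>
    toLex (decide (t ∈ cs.parabolic J), toLex (toLex (cs.normRoot t), embeddingToCardinal t))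
  refine ⟨LinearOrder.lift' k
    (fun a b h => embeddingToCardinal.injective (Prod.ext_iff.1 (Prod.ext_iff.1 h).2).2),
    fun r t hr ht hne => ?_⟩
  have h1 : cs.normRoot r ≠ cs.normRoot t := fun h => hne (cs.normRoot_injOn hr ht h)
  change k r < k t ↔ _
  rw [lexPos_sub_iff]
  by_cases h2 : r ∈ cs.parabolic J <;> by_cases h3 : t ∈ cs.parabolic J <;>
    simp [k, Prod.Lex.toLex_lt_toLex, h2, h3, h1]

theorem lexPos_sign_of_scaled [LinearOrder B] {u : B →₀ ℝ} (hu : u ≠ 0) {c : ℝ} (hc : c ≠ 0)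
    {P Q : Prop} {s s' : ℝ} (hs : (P ∧ s = -1) ∨ (¬ P ∧ s = 1))
    (hs' : (Q ∧ s' = -1) ∨ (¬ Q ∧ s' = 1)) :
    ¬ 0 ≤ c ↔ ¬ ((P ↔ LexPos (-(s • c • u))) ↔ (Q ↔ LexPos (-(s' • u)))) := by
  have h1 : LexPos (-u) ↔ ¬ LexPos u := by
    refine ⟨fun h h' => h'.not_neg h, fun h => (lexPos_neg_or_of_ne_zero hu).resolve_left h⟩
  have h2 : LexPos (-(s • c • u)) ↔ (0 < s * c ↔ ¬ LexPos u) := by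
    have hs0 : s * c ≠ 0 := mul_ne_zero (by rcases hs with ⟨-, rfl⟩ | ⟨-, rfl⟩ <;> norm_num) hc
    rcases lt_or_gt_of_ne hs0 with h | h
    · have e : -(s • c • u) = (-(s * c)) • u := by module
      rw [e, lexPos_smul_iff (by linarith)]
      simp [h.not_gt]
    · have e : -(s • c • u) = (s * c) • -u := by module
      rw [e, lexPos_smul_iff h, h1]
      simp [h]
  have h3 : LexPos (-(s' • u)) ↔ (0 < s' ↔ ¬ LexPos u) := by
    rcases hs' with ⟨-, rfl⟩ | ⟨-, rfl⟩
    · have e : -((-1 : ℝ) • u) = u := by module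
      rw [e]; norm_num
    · have e : -((1 : ℝ) • u) = -u := by module
      rw [e, h1]; norm_num
  rw [h2, h3]
  rcases lt_or_gt_of_ne hc with h | h <;> rcases hs with ⟨hP, rfl⟩ | ⟨hP, rfl⟩ <;>
    rcases hs' with ⟨hQ, rfl⟩ | ⟨hQ, rfl⟩ <;> by_cases hL : LexPos u <;>
    simp [hP, hQ, hL, h, h.le, h.not_ge, h.not_gt]

theorem exists_isTwistedReflectionOrder (J : Set B) :
    ∃ _ : LinearOrder W, cs.IsTwistedReflectionOrder J := by
  obtain ⟨LB, hB⟩ := exists_linearOrder_lt_of_mem J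
  obtain ⟨LW', hlt⟩ := cs.exists_linearOrder_normRoot J
  refine ⟨LW', ?_⟩
  let μ : W → ((B →₀ ℝ) × ℝ) →ₗ[ℝ] (B →₀ ℝ) := fun t => cs.parabolicSign J t • cs.slope t
  have hμ0 : ∀ t, cs.IsReflection t → μ t (cs.root t) = 0 := fun t ht => by
    simp [μ, slope_root _ _ ht]
  have hμ : ∀ r t, cs.IsReflection r → cs.IsReflection t → LW'.lt t r →
      LexPos (μ t (cs.twistedRoot J r)) ∧ LexPos (-μ r (cs.twistedRoot J t)) := by
    intro r t hr ht h
    have hne : t ≠ r := fun e => lt_irrefl _ (e ▸ h)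
    have e1 : μ t (cs.twistedRoot J r) =
        rootHeight (cs.root r) • (cs.parabolicSign J t * cs.parabolicSign J r) •
          (cs.normRoot r - cs.normRoot t) := by
      simp only [μ, twistedRoot, LinearMap.smul_apply, map_smul, slope_root _ _ hr]
      module
    have e2 : -μ r (cs.twistedRoot J t) =
        rootHeight (cs.root t) • (cs.parabolicSign J t * cs.parabolicSign J r) •
          (cs.normRoot r - cs.normRoot t) := by
      simp only [μ, twistedRoot, LinearMap.smul_apply, map_smul, slope_root _ _ ht]
      module
    rw [e1, e2, lexPos_smul_iff hr.rootHeight_pos, lexPos_smul_iff ht.rootHeight_pos, and_self]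
    rw [hlt t r ht hr hne] at h
    rcases cs.parabolicSign_cases J t with ⟨h1, h2⟩ | ⟨h1, h2⟩ <;>
      rcases cs.parabolicSign_cases J r with ⟨h3, h4⟩ | ⟨h3, h4⟩ <;>
      simp only [h1, h3, h2, h4] at h ⊢
    · simpa using h
    · simp at h
    · have := cs.normRoot_lt_of_mem_parabolic hB hr ht h3 h1
      have e : (1 * -1 : ℝ) • (cs.normRoot r - cs.normRoot t) =
        cs.normRoot t - cs.normRoot r := by module
      rwa [e]
    · simpa using h
  have hμ' : ∀ r t, cs.IsReflection r → cs.IsReflection t → r ≠ t →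
      (LW'.lt r t ↔ LexPos (-μ t (cs.twistedRoot J r))) ∧ μ t (cs.twistedRoot J r) ≠ 0 := by
    intro r t hr ht hne
    rcases lt_or_gt_of_ne hne with h | h
    · have h1 := (hμ t r ht hr h).2
      refine ⟨⟨fun _ => h1, fun _ => h⟩, fun h0 => ?_⟩
      rw [h0] at h1
      exact h1.not_neg (by simpa using h1)
    · have h1 := (hμ r t hr ht h).1
      refine ⟨⟨fun h2 => absurd h (lt_asymm h2), fun h2 => absurd h2 h1.not_neg⟩, fun h0 => ?_⟩
      rw [h0] at h1
      exact h1.not_neg (by simpa using h1)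
  refine ⟨fun r t hr ht hne => ?_, fun r t p q hr ht hp hq h1 h2 h3 a b c d ha hb hc hd h => ?_⟩
  · have hr' : cs.IsReflection (t * r * t) := by simpa [ht.inv] using hr.conj t
    have hne' : t * r * t ≠ t := by
      intro h
      apply hne
      have : r = t * (t * r * t) * t := by simp [mul_assoc, ht.mul_self, ← mul_assoc t t]
      rw [this, h, ht.mul_self, one_mul]
    obtain ⟨c, hc, h1⟩ := cs.exists_geomRep_root t hr
    rw [ht.inv] at h1
    obtain ⟨h2, h3⟩ := hμ' r t hr ht hne
    obtain ⟨h4, h5⟩ := hμ' _ t hr' ht hne'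
    have h6 : μ t (cs.root r) = c • μ t (cs.root (t * r * t)) := by
      rw [← map_smul, ← h1, geomRep_reflection _ ht, map_sub, map_smul, hμ0 t ht, smul_zero,
        sub_zero]
    rw [cs.shortens_iff hr, ht.inv, h1, isPos_smul_root _ hr', h2, h4]
    simp only [twistedRoot, map_smul] at h3 h5 ⊢
    rw [h6] at h3 ⊢
    set u := μ t (cs.root (t * r * t)) with hu
    have hu0 : u ≠ 0 := fun h => h5 (by rw [h, smul_zero])
    exact lexPos_sign_of_scaled hu0 hc (cs.parabolicSign_cases J r) (cs.parabolicSign_cases J _)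
  · have e0 : μ t (cs.twistedRoot J t) = 0 := by
      rw [twistedRoot, map_smul, hμ0 t ht, smul_zero]
    have e1 := congrArg (μ t) h
    simp only [map_add, map_smul, e0, smul_zero, zero_add] at e1
    have p1 := (lexPos_smul_iff hb).2 (hμ t r ht hr h1).2
    have p2 := (lexPos_smul_iff hc).2 (hμ p t hp ht h2).1
    have p3 := (lexPos_smul_iff hd).2 (hμ q t hq ht h3).1
    have p4 := p2.add p3
    rw [← e1] at p4
    rw [smul_neg] at p1
    exact p4.not_neg p1

end CoxeterSystem

namespace CoxeterSystem

open CoxeterMatrix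

variable {B : Type*} {M : CoxeterMatrix B} {W : Type*} [Group W] (cs : CoxeterSystem M W)

/-- There is an edge from `x` to `t * x` in the twisted Bruhat graph. -/
def IsUp (J : Set B) (x t : W) : Prop :=
  cs.IsReflection t ∧ (cs.Shortens t x ↔ t ∈ cs.parabolic J)

/-- The transitive closure of the edges of the twisted Bruhat graph. -/
def PathLE (J : Set B) : W → W → Prop :=
  Relation.ReflTransGen fun x y => ∃ t, cs.IsUp J x t ∧ y = t * x

/-- The edge between `x` and `x * s_i` points to `x * s_i`. -/
def IsLow (J : Set B) (x : W) (i : B) : Prop := cs.IsUp J x (x * cs.simple i * x⁻¹)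

variable {cs} {J : Set B}

theorem isUp_mul_self_iff {t : W} (ht : cs.IsReflection t) (x : W) :
    cs.IsUp J (t * x) t ↔ ¬ cs.IsUp J x t := by
  simp only [IsUp, ht, true_and, ht.shortens_mul_self]
  tauto

theorem isUp_empty_iff {t : W} (ht : cs.IsReflection t) (x : W) :
    cs.IsUp ∅ x t ↔ ¬ cs.Shortens t x := by
  have : t ∉ cs.parabolic ∅ := fun h => by
    simp only [parabolic, Set.image_empty, Subgroup.closure_empty, Subgroup.mem_bot] at h
    have := ht.odd_length
    simp [h] at this
  simp [IsUp, ht, this]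

theorem isLow_mul_simple_iff (x : W) (i : B) : cs.IsLow J (x * cs.simple i) i ↔ ¬ cs.IsLow J x i := by
  have ht := (cs.isReflection_simple i).conj x
  rw [IsLow, IsLow, ← isUp_mul_self_iff ht]
  simp [mul_assoc]

theorem isLow_empty_iff (x : W) (i : B) :
    cs.IsLow ∅ x i ↔ ¬ cs.IsRightDescent x i := by
  rw [IsLow, isUp_empty_iff ((cs.isReflection_simple i).conj x), shortens_conj_simple_iff]
  rfl

theorem isUp_mul_simple_iff {x t : W} {i : B} (h : t ≠ x * cs.simple i * x⁻¹) :
    cs.IsUp J (x * cs.simple i) t ↔ cs.IsUp J x t :=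
  and_congr_right fun ht => by rw [cs.shortens_mul_simple_iff ht h]

theorem PathLE.refl (x : W) : cs.PathLE J x x := Relation.ReflTransGen.refl

theorem PathLE.trans {x y z : W} (h : cs.PathLE J x y) (h' : cs.PathLE J y z) : cs.PathLE J x z :=
  Relation.ReflTransGen.trans h h'

theorem IsUp.pathLE {x t : W} (h : cs.IsUp J x t) : cs.PathLE J x (t * x) :=
  Relation.ReflTransGen.single ⟨t, h, rfl⟩

theorem IsLow.pathLE {x : W} {i : B} (h : cs.IsLow J x i) : cs.PathLE J x (x * cs.simple i) := by
  simpa using IsUp.pathLE h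

theorem pathLE_of_not_isLow {x : W} {i : B} (h : ¬ cs.IsLow J x i) :
    cs.PathLE J (x * cs.simple i) x := by
  simpa using ((isLow_mul_simple_iff x i).2 h).pathLE

variable (cs) in
open Classical in
/-- The larger one of `x` and `x * s_i`. -/
noncomputable def upper (J : Set B) (x : W) (i : B) : W :=
  if cs.IsLow J x i then x * cs.simple i else x

variable (cs) in
open Classical in
/-- The smaller one of `x` and `x * s_i`. -/
noncomputable def lower (J : Set B) (x : W) (i : B) : W :=
  if cs.IsLow J x i then x else x * cs.simple i

theorem IsUp.mul_simple {x t : W} {i : B} (h : cs.IsUp J x t) :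
    t * x = x * cs.simple i ∨ cs.PathLE J (x * cs.simple i) (t * x * cs.simple i) := by
  by_cases hx : t = x * cs.simple i * x⁻¹
  · exact Or.inl (by simp [hx])
  · exact Or.inr (by simpa [mul_assoc] using ((isUp_mul_simple_iff hx).2 h).pathLE)

theorem PathLE.le_upper {x y : W} (h : cs.PathLE J x y) (i : B) :
    cs.PathLE J x (cs.upper J y i) := by
  refine h.trans ?_
  rw [upper]
  split_ifs with h
  · exact h.pathLE
  · exact PathLE.refl _

theorem PathLE.lower_le {x y : W} (h : cs.PathLE J x y) (i : B) :
    cs.PathLE J (cs.lower J x i) y := by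
  refine PathLE.trans ?_ h
  rw [lower]
  split_ifs with h
  · exact PathLE.refl _
  · exact pathLE_of_not_isLow h

theorem PathLE.mul_simple_le_upper {x y : W} (h : cs.PathLE J x y) (i : B) :
    cs.PathLE J (x * cs.simple i) (cs.upper J y i) := by
  induction h using Relation.ReflTransGen.head_induction_on with
  | refl =>
    rw [upper]
    split_ifs with h
    · exact PathLE.refl _
    · exact pathLE_of_not_isLow h
  | head h1 h2 ih =>
    obtain ⟨t, ht, rfl⟩ := h1
    rcases ht.mul_simple (i := i) with h | h
    · rw [← h]; exact PathLE.le_upper h2 i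
    · exact h.trans ih

theorem PathLE.lower_le_mul_simple {x y : W} (h : cs.PathLE J x y) (i : B) :
    cs.PathLE J (cs.lower J x i) (y * cs.simple i) := by
  induction h with
  | refl =>
    rw [lower]
    split_ifs with h
    · exact h.pathLE
    · exact PathLE.refl _
  | tail h1 h2 ih =>
    obtain ⟨t, ht, rfl⟩ := h2
    rcases ht.mul_simple (i := i) with h | h
    · rw [h, simple_mul_simple_cancel_right]; exact PathLE.lower_le h1 i
    · exact ih.trans h

theorem PathLE.mul_simple_le {x y : W} (h : cs.PathLE J x y) {i : B} (hy : ¬ cs.IsLow J y i) :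
    cs.PathLE J (x * cs.simple i) y := by
  simpa [upper, hy] using h.mul_simple_le_upper i

theorem PathLE.le_mul_simple {x y : W} (h : cs.PathLE J x y) {i : B} (hx : cs.IsLow J x i) :
    cs.PathLE J x (y * cs.simple i) := by
  simpa [lower, hx] using h.lower_le_mul_simple i

theorem PathLE.mul_simple_le_mul_simple {x y : W} (h : cs.PathLE J x y) {i : B}
    (hxy : ¬ cs.IsLow J x i ∨ cs.IsLow J y i) :
    cs.PathLE J (x * cs.simple i) (y * cs.simple i) := by
  rcases hxy with hx | hy
  · simpa [lower, hx] using h.lower_le_mul_simple i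
  · simpa [upper, hy] using h.mul_simple_le_upper i

theorem PathLE.wordProd_sublist {ω ω' : List B} (hω : cs.IsReduced ω) (h : ω'.Sublist ω) :
    cs.PathLE ∅ (cs.wordProd ω') (cs.wordProd ω) := by
  induction ω using List.reverseRecOn generalizing ω' with
  | nil => rw [List.sublist_nil.1 h]; exact PathLE.refl _
  | append_singleton η i ih =>
    have h1 : cs.IsReduced η := by simpa using hω.take η.length
    have h2 : cs.IsLow ∅ (cs.wordProd η) i := by
      rw [isLow_empty_iff, IsRightDescent, h1.eq]
      have := hω.eq
      rw [wordProd_append, wordProd_singleton] at this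
      simp [this]
    rw [wordProd_append, wordProd_singleton]
    obtain ⟨ζ, ζ', rfl, h3, h4⟩ := List.sublist_append_iff.1 h
    rcases List.sublist_singleton.1 h4 with rfl | rfl
    · rw [List.append_nil]
      exact (ih h1 h3).trans h2.pathLE
    · rw [wordProd_append, wordProd_singleton]
      exact (ih h1 h3).mul_simple_le_mul_simple (Or.inr h2)

theorem exists_reduced_sublist (ω : List B) :
    ∃ ζ : List B, ζ.Sublist ω ∧ cs.IsReduced ζ ∧ cs.wordProd ζ = cs.wordProd ω := by
  induction ω with
  | nil => exact ⟨[], List.Sublist.refl _, by simp [IsReduced], rfl⟩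
  | cons i ω ih =>
    obtain ⟨ζ, h1, h2, h3⟩ := ih
    by_cases hi : cs.Shortens (cs.simple i) (cs.wordProd ζ)
    · obtain ⟨k, hk, h4⟩ := hi.exists_eraseIdx (cs.isReflection_simple i)
      refine ⟨ζ.eraseIdx k, ((ζ.eraseIdx_sublist k).trans h1).cons i, ?_, ?_⟩
      · rw [IsReduced, ← h4, List.length_eraseIdx_of_lt hk]
        have h5 := cs.length_simple_mul (cs.wordProd ζ) i
        rw [Shortens] at hi
        have := h2.eq
        omega
      · rw [← h4, h3, wordProd_cons]
    · refine ⟨i :: ζ, h1.cons_cons i, ?_, by rw [wordProd_cons, wordProd_cons, h3]⟩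
      rw [IsReduced, wordProd_cons]
      have h5 := cs.length_simple_mul (cs.wordProd ζ) i
      rw [Shortens] at hi
      have := h2.eq
      simp only [List.length_cons]
      omega

theorem PathLE.exists_sublist {v w : W} (h : cs.PathLE ∅ v w) {ω : List B}
    (hw : cs.wordProd ω = w) (hω : cs.IsReduced ω) :
    ∃ ω' : List B, ω'.Sublist ω ∧ cs.IsReduced ω' ∧ cs.wordProd ω' = v := by
  induction h generalizing ω with
  | refl => exact ⟨ω, List.Sublist.refl _, hω, hw⟩
  | tail h1 h2 ih =>
    obtain ⟨t, ht, rfl⟩ := h2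
    have h3 := (isUp_empty_iff ht.1 _).1 ht
    rw [← ht.1.shortens_mul_self, ← hw] at h3
    obtain ⟨k, hk, h4⟩ := h3.exists_eraseIdx ht.1
    obtain ⟨ζ, h5, h6, h7⟩ := exists_reduced_sublist (cs := cs) (ω.eraseIdx k)
    obtain ⟨ω', h8, h9⟩ := ih (ω := ζ) (by
      rw [h7, ← h4, hw, ← mul_assoc, ht.1.mul_self, one_mul]) h6
    exact ⟨ω', (h8.trans h5).trans (ω.eraseIdx_sublist k), h9⟩

theorem bruhatLE_iff_pathLE {v w : W} : bruhatLE cs v w ↔ cs.PathLE ∅ v w := by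
  constructor
  · rintro ⟨ω, h1, rfl, ω', h2, -, rfl⟩
    exact PathLE.wordProd_sublist h1 h2
  · intro h
    obtain ⟨ω, h1, h2⟩ := cs.exists_isReduced w
    exact ⟨ω, h1, h2.symm, h.exists_sublist h2.symm h1⟩

end CoxeterSystem

namespace CoxeterSystem

open CoxeterMatrix

variable {B : Type*} {M : CoxeterMatrix B} {W : Type*} [Group W] (cs : CoxeterSystem M W)

/-- The minimality of `b` in its coset modulo the parabolic subgroup of type `J`. -/
def IsMinRep (J : Set B) (b : W) : Prop := ∀ i ∈ J, cs.length (cs.simple i * b) > cs.length b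

/-- The maps `wJ` and `Jw` give the parabolic factorizations with respect to `J`. -/
structure IsParabolicFactorization (J : Set B) (wJ Jw : W → W) : Prop where
  mem : ∀ w, wJ w ∈ cs.parabolic J
  isMinRep : ∀ w, cs.IsMinRep J (Jw w)
  eq_mul : ∀ w, w = wJ w * Jw w
  length_eq : ∀ w, cs.length w = cs.length (wJ w) + cs.length (Jw w)
  unique : ∀ w a b, a ∈ cs.parabolic J → cs.IsMinRep J b → w = a * b → a = wJ w ∧ b = Jw w

/-- The twisted length. -/
noncomputable def twistedLength (wJ Jw : W → W) (w : W) : ℤ := (cs.length (Jw w) : ℤ) - cs.length (wJ w)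

variable {cs} {J : Set B} {wJ Jw : W → W}

theorem isMinRep_one : cs.IsMinRep J 1 := fun i _ => by simp

/-- Deodhar's lemma. -/
theorem IsMinRep.mul_simple_cases {b : W} (hb : cs.IsMinRep J b) (i : B) :
    cs.IsMinRep J (b * cs.simple i) ∨ ∃ j ∈ J, b * cs.simple i = cs.simple j * b := by
  by_cases h : cs.IsMinRep J (b * cs.simple i)
  · exact Or.inl h
  · right
    simp only [IsMinRep, not_forall] at h
    obtain ⟨j, hj, h⟩ := h
    refine ⟨j, hj, ?_⟩
    by_cases he : cs.simple j = b * cs.simple i * b⁻¹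
    · simp [he]
    · have h1 := cs.shortens_mul_simple_iff (cs.isReflection_simple j) he
      have h2 := hb j hj
      have h3 := cs.length_simple_mul_ne (b * cs.simple i) j
      simp only [Shortens] at h1
      omega

theorem IsMinRep.mul_simple_of_isRightDescent {b : W} (hb : cs.IsMinRep J b) {i : B}
    (hi : cs.IsRightDescent b i) : cs.IsMinRep J (b * cs.simple i) := by
  rcases hb.mul_simple_cases i with h | ⟨j, hj, h⟩
  · exact h
  · have h1 := hb j hj
    rw [IsRightDescent, h] at hi
    omega

namespace IsParabolicFactorization

variable (h : cs.IsParabolicFactorization J wJ Jw)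
include h

theorem wJ_mul {a b : W} (ha : a ∈ cs.parabolic J) (hb : cs.IsMinRep J b) : wJ (a * b) = a :=
  (h.unique _ a b ha hb rfl).1.symm

theorem Jw_mul {a b : W} (ha : a ∈ cs.parabolic J) (hb : cs.IsMinRep J b) : Jw (a * b) = b :=
  (h.unique _ a b ha hb rfl).2.symm

theorem length_mul {a b : W} (ha : a ∈ cs.parabolic J) (hb : cs.IsMinRep J b) :
    cs.length (a * b) = cs.length a + cs.length b := by
  rw [h.length_eq, h.wJ_mul ha hb, h.Jw_mul ha hb]

theorem twistedLength_mul {a b : W} (ha : a ∈ cs.parabolic J) (hb : cs.IsMinRep J b) :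
    cs.twistedLength wJ Jw (a * b) = cs.length b - cs.length a := by
  rw [twistedLength, h.wJ_mul ha hb, h.Jw_mul ha hb]

theorem exists_eq_mul (w : W) : ∃ a b, a ∈ cs.parabolic J ∧ cs.IsMinRep J b ∧ w = a * b :=
  ⟨wJ w, Jw w, h.mem w, h.isMinRep w, h.eq_mul w⟩

theorem shortens_mul_iff {a b t : W} (ha : a ∈ cs.parabolic J) (hb : cs.IsMinRep J b)
    (ht : t ∈ cs.parabolic J) : cs.Shortens t (a * b) ↔ cs.Shortens t a := by
  rw [Shortens, ← mul_assoc, h.length_mul (mul_mem ht ha) hb, h.length_mul ha hb, Shortens]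
  omega

/-- A reflection outside of the parabolic subgroup acts on the minimal representative. -/
theorem exists_of_shortens {a b t : W} (ht : cs.IsReflection t) (hs : cs.Shortens t (a * b))
    (htJ : t ∉ cs.parabolic J) (ha : a ∈ cs.parabolic J) (hb : cs.IsMinRep J b) :
    ∃ u d, u ∈ cs.parabolic J ∧ cs.IsMinRep J d ∧ t * (a * b) = a * u * d ∧
      cs.length u + cs.length d < cs.length b ∧ cs.PathLE ∅ (u * d) b := by
  obtain ⟨ω, hω, rfl⟩ := exists_word_of_mem_parabolic ha
  obtain ⟨η, hη, rfl⟩ := cs.exists_isReduced b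
  rw [← wordProd_append] at hs ⊢
  obtain ⟨k, hk, h1⟩ := hs.exists_eraseIdx ht
  rcases lt_or_ge k ω.length with hk' | hk'
  · refine absurd ?_ htJ
    rw [List.eraseIdx_append_of_lt_length hk', wordProd_append, wordProd_append, ← mul_assoc,
      mul_left_inj] at h1
    rw [eq_mul_inv_of_mul_eq h1]
    exact mul_mem (wordProd_mem_parabolic fun j hj => hω j (List.mem_of_mem_eraseIdx hj))
      (inv_mem ha)
  · rw [List.eraseIdx_append_of_length_le hk', wordProd_append] at h1
    obtain ⟨u, d, hu, hd, hud⟩ := h.exists_eq_mul (cs.wordProd (η.eraseIdx (k - ω.length)))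
    refine ⟨u, d, hu, hd, by rw [wordProd_append, h1, wordProd_append, hud, mul_assoc], ?_, ?_⟩
    · rw [← h.length_mul hu hd, ← hud, hη.eq]
      refine (cs.length_wordProd_le _).trans_lt ?_
      rw [List.length_append] at hk
      rw [List.length_eraseIdx_of_lt (by omega)]
      omega
    · rw [← hud]
      exact PathLE.wordProd_sublist hη (List.eraseIdx_sublist _ _)

theorem twistedLength_lt_of_isUp {x t : W} (hx : cs.IsUp J x t) :
    cs.twistedLength wJ Jw x < cs.twistedLength wJ Jw (t * x) := by
  obtain ⟨ht, hx⟩ := hx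
  by_cases htJ : t ∈ cs.parabolic J
  · obtain ⟨a, b, ha, hb, rfl⟩ := h.exists_eq_mul x
    have h1 := hx.2 htJ
    rw [h.shortens_mul_iff ha hb htJ, Shortens] at h1
    rw [← mul_assoc, h.twistedLength_mul ha hb, h.twistedLength_mul (mul_mem htJ ha) hb]
    omega
  · have h1 : cs.Shortens t (t * x) := (ht.shortens_mul_self x).2 fun h => htJ (hx.1 h)
    have h2 : x = t * (t * x) := by rw [← mul_assoc, ht.mul_self, one_mul]
    obtain ⟨a, b, ha, hb, hab⟩ := h.exists_eq_mul (t * x)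
    rw [hab] at h1 h2 ⊢
    obtain ⟨u, d, hu, hd, h3, h4, -⟩ := h.exists_of_shortens ht h1 htJ ha hb
    rw [h2, h3, h.twistedLength_mul (mul_mem ha hu) hd, h.twistedLength_mul ha hb]
    have := cs.length_le_length_mul_add_right a u
    omega

theorem twistedLength_mul_simple (x : W) (i : B) :
    cs.twistedLength wJ Jw (x * cs.simple i) = cs.twistedLength wJ Jw x + 1 ∨
      cs.twistedLength wJ Jw (x * cs.simple i) + 1 = cs.twistedLength wJ Jw x := by
  obtain ⟨a, b, ha, hb, rfl⟩ := h.exists_eq_mul x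
  rcases hb.mul_simple_cases i with h1 | ⟨j, hj, h1⟩
  · rw [mul_assoc, h.twistedLength_mul ha h1, h.twistedLength_mul ha hb]
    have := cs.length_mul_simple b i
    omega
  · rw [mul_assoc, h1, ← mul_assoc, h.twistedLength_mul (mul_mem ha (simple_mem_parabolic hj)) hb,
      h.twistedLength_mul ha hb]
    have := cs.length_mul_simple a j
    omega

theorem twistedLength_of_isLow {x : W} {i : B} (hx : cs.IsLow J x i) :
    cs.twistedLength wJ Jw (x * cs.simple i) = cs.twistedLength wJ Jw x + 1 := by
  have h1 := h.twistedLength_lt_of_isUp hx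
  rw [inv_mul_cancel_right] at h1
  have := h.twistedLength_mul_simple x i
  omega

theorem twistedLength_of_not_isLow {x : W} {i : B} (hx : ¬ cs.IsLow J x i) :
    cs.twistedLength wJ Jw (x * cs.simple i) + 1 = cs.twistedLength wJ Jw x := by
  have := h.twistedLength_of_isLow ((isLow_mul_simple_iff x i).2 hx)
  rw [simple_mul_simple_cancel_right] at this
  exact this.symm

theorem twistedLength_le {x y : W} (hxy : cs.PathLE J x y) :
    cs.twistedLength wJ Jw x ≤ cs.twistedLength wJ Jw y := by
  induction hxy with
  | refl => exact le_rfl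
  | tail _ h2 ih =>
    obtain ⟨t, ht, rfl⟩ := h2
    exact ih.trans (h.twistedLength_lt_of_isUp ht).le

theorem eq_of_twistedLength_le {x y : W} (hxy : cs.PathLE J x y)
    (hl : cs.twistedLength wJ Jw y ≤ cs.twistedLength wJ Jw x) : x = y := by
  cases hxy with
  | refl => rfl
  | tail h1 h2 =>
    obtain ⟨t, ht, rfl⟩ := h2
    exact absurd hl (not_le.2 ((h.twistedLength_le h1).trans_lt (h.twistedLength_lt_of_isUp ht)))

theorem pathLE_antisymm {x y : W} (hxy : cs.PathLE J x y) (hyx : cs.PathLE J y x) : x = y :=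
  h.eq_of_twistedLength_le hxy (h.twistedLength_le hyx)

theorem not_isLow_of_isRightDescent {a b : W} (ha : a ∈ cs.parabolic J) (hb : cs.IsMinRep J b)
    {i : B} (hi : cs.IsRightDescent b i) : ¬ cs.IsLow J (a * b) i := fun hl => by
  have h1 := h.twistedLength_of_isLow hl
  rw [mul_assoc, h.twistedLength_mul ha (hb.mul_simple_of_isRightDescent hi),
    h.twistedLength_mul ha hb] at h1
  rw [IsRightDescent] at hi
  omega

theorem pathLE_mul_left {c b y : W} (hc : c ∈ cs.parabolic J) (hb : cs.IsMinRep J b)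
    (hy : cs.PathLE ∅ y b) : cs.PathLE J (c * y) (c * b) := by
  induction hn : cs.length b using Nat.strong_induction_on generalizing b y with
  | _ n ih =>
    by_cases hb1 : b = 1
    · subst hb1
      obtain ⟨ω, h1, h2, ω', h3, -, rfl⟩ := bruhatLE_iff_pathLE.2 hy
      have : ω = [] := List.length_eq_zero_iff.1 (by rw [← h1.eq, h2, cs.length_one])
      rw [this, List.sublist_nil] at h3
      rw [h3, wordProd_nil]
      exact PathLE.refl _
    · obtain ⟨i, hi⟩ := cs.exists_rightDescent_of_ne_one hb1
      have hb' := hb.mul_simple_of_isRightDescent hi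
      have h1 : cs.PathLE J (c * b * cs.simple i) (c * b) :=
        pathLE_of_not_isLow (h.not_isLow_of_isRightDescent hc hb hi)
      have h2 := ih (cs.length (b * cs.simple i)) (by rw [← hn]; exact hi) hb'
        (hy.lower_le_mul_simple i) rfl
      rw [← mul_assoc] at h2
      rw [lower] at h2
      split_ifs at h2 with hl
      · exact h2.trans h1
      · have h3 := (h2.trans h1).mul_simple_le (h.not_isLow_of_isRightDescent hc hb hi)
        rwa [mul_assoc, simple_mul_simple_cancel_right] at h3

theorem mul_pathLE_mul {a a' b : W} (ha' : a' ∈ cs.parabolic J) (hb : cs.IsMinRep J b)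
    (haa' : cs.PathLE ∅ a a') : cs.PathLE J (a' * b) (a * b) := by
  induction haa' with
  | refl => exact PathLE.refl _
  | tail h1 h2 ih =>
    rename_i z a'
    obtain ⟨t, ht, rfl⟩ := h2
    have h2 : cs.Shortens t (t * z) :=
      (ht.1.shortens_mul_self z).2 ((isUp_empty_iff ht.1 z).1 ht)
    have h3 : t ∈ cs.parabolic J := h2.mem_parabolic ht.1 ha'
    have hz : z ∈ cs.parabolic J := (Subgroup.mul_mem_cancel_left _ h3).1 ha'
    refine PathLE.trans ?_ (ih hz)
    have h4 : cs.IsUp J (t * z * b) t :=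
      ⟨ht.1, iff_of_true ((h.shortens_mul_iff ha' hb h3).2 h2) h3⟩
    have h5 := h4.pathLE
    rwa [← mul_assoc, ← mul_assoc, ht.1.mul_self, one_mul] at h5

theorem pathLE_of_twistedLE {v w : W} (hvw : twistedLE cs J wJ Jw v w) : cs.PathLE J v w := by
  obtain ⟨u, hu, h1, h2⟩ := hvw
  rw [bruhatLE_iff_pathLE] at h1 h2
  have hc : wJ v * u⁻¹ ∈ cs.parabolic J := mul_mem (h.mem v) (inv_mem hu)
  have h3 := (h.pathLE_mul_left hc (h.isMinRep w) h2).trans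
    (h.mul_pathLE_mul hc (h.isMinRep w) h1)
  rwa [← h.eq_mul, ← mul_assoc, inv_mul_cancel_right, ← h.eq_mul] at h3

omit h in
theorem exists_sublist_pathLE_mul {x y : W} (hxy : cs.PathLE J x y) (ω : List B) :
    ∃ ω' : List B, ω'.Sublist ω ∧ cs.PathLE J (x * cs.wordProd ω) (y * cs.wordProd ω') := by
  induction ω generalizing x y with
  | nil => exact ⟨[], List.Sublist.refl _, by simpa using hxy⟩
  | cons i ω ih =>
    have h1 := hxy.mul_simple_le_upper i
    rw [upper] at h1
    split_ifs at h1 with hl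
    · obtain ⟨ω', h2, h3⟩ := ih h1
      exact ⟨i :: ω', h2.cons_cons i, by simpa [wordProd_cons, mul_assoc] using h3⟩
    · obtain ⟨ω', h2, h3⟩ := ih h1
      exact ⟨ω', h2.cons i, by simpa [wordProd_cons, mul_assoc] using h3⟩

theorem twistedLE_of_pathLE {v w : W} (hvw : cs.PathLE J v w) : twistedLE cs J wJ Jw v w := by
  simp only [twistedLE, bruhatLE_iff_pathLE]
  induction hvw with
  | refl => exact ⟨1, one_mem _, by simpa using PathLE.refl _, by simpa using PathLE.refl _⟩
  | tail h1 h2 ih =>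
    rename_i x w
    obtain ⟨t, ⟨ht, hx⟩, rfl⟩ := h2
    obtain ⟨u, hu, h2, h3⟩ := ih
    by_cases htJ : t ∈ cs.parabolic J
    · refine ⟨u, hu, ?_⟩
      obtain ⟨a, b, ha, hb, rfl⟩ := h.exists_eq_mul x
      have h4 := hx.2 htJ
      rw [h.wJ_mul ha hb] at h2
      rw [h.Jw_mul ha hb] at h3
      rw [h.shortens_mul_iff ha hb htJ] at h4
      rw [← mul_assoc, h.wJ_mul (mul_mem htJ ha) hb, h.Jw_mul (mul_mem htJ ha) hb]
      refine ⟨PathLE.trans ?_ h2, h3⟩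
      have h5 : cs.IsUp ∅ (t * a) t := (isUp_mul_self_iff ht a).2 (by
        rw [isUp_empty_iff ht, not_not]; exact h4)
      have h6 := h5.pathLE
      rwa [← mul_assoc, ht.mul_self, one_mul] at h6
    · have h4 : cs.Shortens t (t * x) := (ht.shortens_mul_self x).2 fun h => htJ (hx.1 h)
      have h5 : x = t * (t * x) := by rw [← mul_assoc, ht.mul_self, one_mul]
      obtain ⟨a, b, ha, hb, hab⟩ := h.exists_eq_mul (t * x)
      rw [hab] at h4 h5 ⊢
      obtain ⟨u₀, d, hu₀, hd, h6, h7, h8⟩ := h.exists_of_shortens ht h4 htJ ha hb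
      rw [h.wJ_mul ha hb, h.Jw_mul ha hb]
      rw [h5, h6, h.wJ_mul (mul_mem ha hu₀) hd] at h2
      rw [h5, h6, h.Jw_mul (mul_mem ha hu₀) hd] at h3
      obtain ⟨ω₀, hω₀, rfl⟩ := exists_word_of_mem_parabolic hu₀
      obtain ⟨ω, hωω₀, hω, hω'⟩ := exists_reduced_sublist (cs := cs) ω₀
      rw [← hω'] at h2 h6 h7 h8 hu₀
      obtain ⟨ζ, hζ, h9⟩ := exists_sublist_pathLE_mul h2 ω.reverse
      rw [wordProd_reverse, mul_inv_cancel_right] at h9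
      obtain ⟨η, hη, rfl, η', hη', -, h10⟩ := bruhatLE_iff_pathLE.2 h3
      have h11 : cs.IsReduced (ω ++ η) := by
        rw [IsReduced, wordProd_append, h.length_mul hu₀ hd, hω.eq, hη.eq, List.length_append]
      have hζ' := hζ.reverse
      rw [List.reverse_reverse] at hζ'
      have h12 := PathLE.wordProd_sublist h11 (hζ'.append hη')
      have h13 : cs.PathLE ∅ ((cs.wordProd ζ)⁻¹ * (u * Jw v)) b := by
        refine PathLE.trans ?_ h8
        rw [← h10]
        simpa [wordProd_append, wordProd_reverse] using h12
      have hζJ : cs.wordProd ζ ∈ cs.parabolic J := wordProd_mem_parabolic fun j hj =>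
        hω₀ j (hωω₀.mem (by simpa using hζ.mem hj))
      refine ⟨(cs.wordProd ζ)⁻¹ * u, mul_mem (inv_mem hζJ) hu, ?_, by rwa [mul_assoc]⟩
      rwa [mul_inv_rev, inv_inv, ← mul_assoc]

theorem twistedLE_iff_pathLE {v w : W} : twistedLE cs J wJ Jw v w ↔ cs.PathLE J v w :=
  ⟨h.pathLE_of_twistedLE, h.twistedLE_of_pathLE⟩

omit h in
/-- If `w` lies in the parabolic subgroup, then so does everything below it. -/
theorem mem_parabolic_of_pathLE {v w : W} (hvw : cs.PathLE J v w) (hw : w ∈ cs.parabolic J) :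
    v ∈ cs.parabolic J := by
  induction hvw with
  | refl => exact hw
  | tail h1 h2 ih =>
    rename_i x w
    obtain ⟨t, ⟨ht, hx⟩, rfl⟩ := h2
    have htJ : t ∈ cs.parabolic J := by
      by_contra htJ
      have h4 : cs.Shortens t (t * x) := (ht.shortens_mul_self x).2 fun h => htJ (hx.1 h)
      exact htJ (h4.mem_parabolic ht hw)
    exact ih ((Subgroup.mul_mem_cancel_left _ htJ).1 hw)

/-- Induction on the intervals, moving both ends by a simple reflection. -/
theorem interval_induction {Q : W → W → Prop} (refl : ∀ v, Q v v)
    (step : ∀ v w i, cs.PathLE J v w → (cs.IsLow J v i ∨ ¬ cs.IsLow J w i) →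
      (∀ v' w', cs.PathLE J v' w' →
        cs.twistedLength wJ Jw w' - cs.twistedLength wJ Jw v' <
          cs.twistedLength wJ Jw w - cs.twistedLength wJ Jw v → Q v' w') →
      ((cs.IsLow J v i ↔ cs.IsLow J w i) → Q (v * cs.simple i) (w * cs.simple i)) → Q v w)
    {v w : W} (hvw : cs.PathLE J v w) : Q v w := by
  induction hn : (cs.twistedLength wJ Jw w - cs.twistedLength wJ Jw v).toNat
    using Nat.strong_induction_on generalizing v w with
  | _ n ih =>
    have ih' : ∀ v' w', cs.PathLE J v' w' →
        cs.twistedLength wJ Jw w' - cs.twistedLength wJ Jw v' <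
          cs.twistedLength wJ Jw w - cs.twistedLength wJ Jw v → Q v' w' := by
      intro v' w' h1 h2
      have := h.twistedLength_le h1
      exact ih _ (by omega) h1 rfl
    clear ih
    have key : ∀ {v w : W} {i : B}, (cs.IsLow J v i ↔ cs.IsLow J w i) →
        cs.twistedLength wJ Jw (w * cs.simple i) - cs.twistedLength wJ Jw (v * cs.simple i) =
          cs.twistedLength wJ Jw w - cs.twistedLength wJ Jw v := by
      intro v w i hi
      by_cases hv : cs.IsLow J v i
      · have h1 := h.twistedLength_of_isLow hv
        have h2 := h.twistedLength_of_isLow (hi.1 hv)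
        omega
      · have h1 := h.twistedLength_of_not_isLow hv
        have h2 := h.twistedLength_of_not_isLow fun h => hv (hi.2 h)
        omega
    clear hn
    induction hm : cs.length (Jw w) using Nat.strong_induction_on generalizing v w with
    | _ m ihm =>
      obtain ⟨a, b, ha, hb, rfl⟩ := h.exists_eq_mul w
      rw [h.Jw_mul ha hb] at hm
      by_cases hb1 : b = 1
      · subst hb1
        clear ihm hm
        rw [mul_one] at *
        induction hm : cs.length v using Nat.strong_induction_on generalizing v a with
        | _ m ihm =>
          have hv := mem_parabolic_of_pathLE hvw ha
          by_cases hv1 : v = 1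
          · subst hv1
            obtain rfl : 1 = a := h.eq_of_twistedLength_le hvw (by
              have h1 := h.twistedLength_mul ha isMinRep_one
              have h2 := h.twistedLength_mul hv isMinRep_one
              rw [mul_one] at h1 h2
              rw [h1, h2, cs.length_one]
              omega)
            exact refl _
          · obtain ⟨i, hi⟩ := cs.exists_rightDescent_of_ne_one hv1
            have hiJ := simple_mem_parabolic (cs := cs) (mem_of_rightDescent_of_mem_parabolic hv hi)
            have hlow : cs.IsLow J v i := by
              by_contra hl
              have h1 := h.twistedLength_of_not_isLow hl
              have h2 := h.twistedLength_mul hv isMinRep_one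
              have h3 := h.twistedLength_mul (mul_mem hv hiJ) isMinRep_one
              rw [mul_one] at h2 h3
              rw [h2, h3] at h1
              rw [IsRightDescent] at hi
              omega
            refine step _ _ i hvw (Or.inl hlow) ih' fun hi' => ?_
            exact ihm _ (by rw [← hm]; exact hi) _ (mul_mem ha hiJ)
              (hvw.mul_simple_le_mul_simple (Or.inr (hi'.1 hlow)))
              (fun v' w' h1 h2 => ih' v' w' h1 (by rwa [← key hi'])) rfl
      · obtain ⟨i, hi⟩ := cs.exists_rightDescent_of_ne_one hb1
        have hl := h.not_isLow_of_isRightDescent ha hb hi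
        refine step _ _ i hvw (Or.inr hl) ih' fun hi' => ?_
        refine ihm _ ?_ (hvw.mul_simple_le_mul_simple (Or.inl fun h => hl (hi'.1 h)))
          (fun v' w' h1 h2 => ih' v' w' h1 (by rwa [← key hi'])) rfl
        rw [mul_assoc, h.Jw_mul ha (hb.mul_simple_of_isRightDescent hi), ← hm]
        exact hi

end IsParabolicFactorization

end CoxeterSystem

namespace CoxeterSystem

open CoxeterMatrix

variable {B : Type*} {M : CoxeterMatrix B} {W : Type*} [Group W] {cs : CoxeterSystem M W}
variable {J : Set B} {wJ Jw : W → W}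

namespace IsParabolicFactorization

variable (h : cs.IsParabolicFactorization J wJ Jw)
include h

theorem finite_interval (v w : W) : {x | cs.PathLE J v x ∧ cs.PathLE J x w}.Finite := by
  by_cases hvw : cs.PathLE J v w
  swap
  · convert Set.finite_empty
    exact Set.eq_empty_of_forall_notMem fun x hx => hvw (hx.1.trans hx.2)
  refine h.interval_induction (Q := fun v w => {x | cs.PathLE J v x ∧ cs.PathLE J x w}.Finite)
    (fun v => ?_) (fun v w i hvw hi hQ hQ' => ?_) hvw
  · exact (Set.finite_singleton v).subset fun x hx => h.pathLE_antisymm hx.2 hx.1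
  · have hQ1 : ∀ v' w', cs.twistedLength wJ Jw w' - cs.twistedLength wJ Jw v' <
        cs.twistedLength wJ Jw w - cs.twistedLength wJ Jw v →
        {x | cs.PathLE J v' x ∧ cs.PathLE J x w'}.Finite := by
      intro v' w' h1
      by_cases h2 : cs.PathLE J v' w'
      · exact hQ v' w' h2 h1
      · convert Set.finite_empty
        exact Set.eq_empty_of_forall_notMem fun x hx => h2 (hx.1.trans hx.2)
    by_cases hv : cs.IsLow J v i <;> by_cases hw : cs.IsLow J w i
    · have hrank := h.twistedLength_of_isLow hv
      refine ((hQ1 (v * cs.simple i) w (by omega)).union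
        ((hQ' (by simp [hv, hw])).image (· * cs.simple i))).subset fun x ⟨hx, hx'⟩ => ?_
      by_cases hxl : cs.IsLow J x i
      · exact Or.inr ⟨x * cs.simple i, ⟨hx.mul_simple_le_mul_simple (Or.inr hxl),
          hx'.mul_simple_le_mul_simple (Or.inr hw)⟩, by simp⟩
      · exact Or.inl ⟨hx.mul_simple_le hxl, hx'⟩
    · have hrank := h.twistedLength_of_not_isLow hw
      have hf := hQ1 v (w * cs.simple i) (by omega)
      refine (hf.union (hf.image (· * cs.simple i))).subset fun x ⟨hx, hx'⟩ => ?_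
      by_cases hxl : cs.IsLow J x i
      · exact Or.inl ⟨hx, hx'.le_mul_simple hxl⟩
      · exact Or.inr ⟨x * cs.simple i, ⟨hx.le_mul_simple hv,
          hx'.mul_simple_le_mul_simple (Or.inl hxl)⟩, by simp⟩
    · tauto
    · have hrank := h.twistedLength_of_not_isLow hw
      refine ((hQ1 v (w * cs.simple i) (by omega)).union
        ((hQ' (by simp [hv, hw])).image (· * cs.simple i))).subset fun x ⟨hx, hx'⟩ => ?_
      by_cases hxl : cs.IsLow J x i
      · exact Or.inl ⟨hx, hx'.le_mul_simple hxl⟩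
      · exact Or.inr ⟨x * cs.simple i, ⟨hx.mul_simple_le_mul_simple (Or.inl hv),
          hx'.mul_simple_le_mul_simple (Or.inl hxl)⟩, by simp⟩

theorem exists_cover {v w : W} (hvw : cs.PathLE J v w) (hne : v ≠ w) :
    ∃ t, cs.IsUp J v t ∧ cs.PathLE J (t * v) w ∧
      cs.twistedLength wJ Jw (t * v) = cs.twistedLength wJ Jw v + 1 := by
  revert hne
  refine h.interval_induction (Q := fun v w => v ≠ w → ∃ t, cs.IsUp J v t ∧
    cs.PathLE J (t * v) w ∧ cs.twistedLength wJ Jw (t * v) = cs.twistedLength wJ Jw v + 1)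
    (fun v hv => absurd rfl hv) (fun v w i hvw hi hQ hQ' hne => ?_) hvw
  have hs : cs.IsLow J v i → cs.PathLE J (v * cs.simple i) w → ∃ t, cs.IsUp J v t ∧
      cs.PathLE J (t * v) w ∧
      cs.twistedLength wJ Jw (t * v) = cs.twistedLength wJ Jw v + 1 := by
    intro hv hvw'
    refine ⟨_, hv, ?_⟩
    rw [inv_mul_cancel_right]
    exact ⟨hvw', h.twistedLength_of_isLow hv⟩
  by_cases hv : cs.IsLow J v i <;> by_cases hw : cs.IsLow J w i
  · obtain ⟨t, ht, htw, hr⟩ := hQ' (by simp [hv, hw]) (by simpa using hne)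
    have hne' : t ≠ v * cs.simple i * v⁻¹ := by
      rintro rfl
      exact (isUp_mul_self_iff ht.1 v).1 (by simpa using ht) hv
    by_cases hz : cs.IsLow J (t * (v * cs.simple i)) i
    · refine hs hv (ht.pathLE.trans ?_)
      simpa using htw.le_mul_simple hz
    · refine ⟨t, (isUp_mul_simple_iff hne').1 ht, ?_, ?_⟩
      · simpa [mul_assoc] using htw.mul_simple_le_mul_simple (Or.inl hz)
      · have h1 := h.twistedLength_of_not_isLow hz
        have h2 := h.twistedLength_of_isLow hv
        rw [mul_assoc, simple_mul_simple_cancel_right] at h1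
        omega
  · exact hs hv (hvw.mul_simple_le hw)
  · tauto
  · obtain ⟨t, ht, htw, hr⟩ := hQ' (by simp [hv, hw]) (by simpa using hne)
    by_cases hne' : t = v * cs.simple i * v⁻¹
    · have htw' : cs.PathLE J v (w * cs.simple i) := by simpa [hne', mul_assoc] using htw
      have h1 := h.twistedLength_of_not_isLow hw
      obtain ⟨t', h2, h3, h4⟩ := hQ v (w * cs.simple i) htw' (by omega) (fun e => hv (by
        rw [e, isLow_mul_simple_iff]; exact hw))
      exact ⟨t', h2, h3.trans (pathLE_of_not_isLow hw), h4⟩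
    · have ht' := (isUp_mul_simple_iff hne').1 ht
      refine ⟨t, ht', ?_, ?_⟩
      · simpa [mul_assoc] using (htw.trans (pathLE_of_not_isLow hw)).mul_simple_le hw
      · have h1 := h.twistedLength_lt_of_isUp ht'
        have h2 := h.twistedLength_of_not_isLow hv
        have h3 := h.twistedLength_mul_simple (t * v) i
        rw [mul_assoc] at h3
        omega

omit h in
theorem exists_pair_of_swap {P P' : W → Prop} (s a b : W)
    (hP : ∀ x, P x ↔ (x = b ∧ P' a) ∨ (P' (x * s) ∧ x * s ≠ a)) (hb : ¬ P' (b * s))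
    (hP' : ∃ p q, p ≠ q ∧ ∀ x, P' x ↔ x = p ∨ x = q) :
    ∃ p q, p ≠ q ∧ ∀ x, P x ↔ x = p ∨ x = q := by
  obtain ⟨p, q, hpq, hP'⟩ := hP'
  simp only [hP'] at hP hb
  have e : ∀ x y : W, x * s = y ↔ x = y * s⁻¹ := fun x y => by rw [eq_mul_inv_iff_mul_eq]
  simp only [Ne, e, not_or] at hP hb
  rcases eq_or_ne p a with rfl | hpa
  · refine ⟨b, q * s⁻¹, hb.2, fun x => ?_⟩
    rw [hP]
    constructor
    · tauto
    · rintro (rfl | rfl)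
      · tauto
      · simp [hpq.symm]
  rcases eq_or_ne q a with rfl | hqa
  · refine ⟨b, p * s⁻¹, hb.1, fun x => ?_⟩
    rw [hP]
    constructor
    · tauto
    · rintro (rfl | rfl)
      · tauto
      · simp [hpq]
  · refine ⟨p * s⁻¹, q * s⁻¹, by simpa using hpq, fun x => ?_⟩
    rw [hP]
    constructor
    · rintro (⟨-, h | h⟩ | h)
      · exact absurd h.symm hpa
      · exact absurd h.symm hqa
      · exact h.1
    · rintro (rfl | rfl)
      · simp [hpa]
      · simp [hqa]

theorem exists_pair {v w : W} (hvw : cs.PathLE J v w)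
    (hr : cs.twistedLength wJ Jw w = cs.twistedLength wJ Jw v + 2) :
    ∃ p q, p ≠ q ∧ ∀ x, (cs.PathLE J v x ∧ cs.PathLE J x w ∧
      cs.twistedLength wJ Jw x = cs.twistedLength wJ Jw v + 1) ↔ x = p ∨ x = q := by
  revert hr
  refine h.interval_induction (Q := fun v w =>
    cs.twistedLength wJ Jw w = cs.twistedLength wJ Jw v + 2 →
    ∃ p q, p ≠ q ∧ ∀ x, (cs.PathLE J v x ∧ cs.PathLE J x w ∧
      cs.twistedLength wJ Jw x = cs.twistedLength wJ Jw v + 1) ↔ x = p ∨ x = q)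
    (fun v hv => by omega) (fun v w i hvw hi hQ hQ' hr => ?_) hvw
  have hhigh : ∀ {x}, ¬ cs.IsLow J x i → cs.IsLow J (x * cs.simple i) i :=
    fun hx => (isLow_mul_simple_iff _ i).2 hx
  by_cases hv : cs.IsLow J v i <;> by_cases hw : cs.IsLow J w i
  · have rv := h.twistedLength_of_isLow hv
    have rw' := h.twistedLength_of_isLow hw
    refine exists_pair_of_swap (cs.simple i) w (v * cs.simple i) (fun x => ?_) ?_
      (hQ' (by simp [hv, hw]) (by omega))
    · have hx0 := h.twistedLength_mul_simple x i
      constructor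
      · rintro ⟨h1, h2, h3⟩
        by_cases hx : cs.IsLow J x i
        · have rx := h.twistedLength_of_isLow hx
          exact Or.inr ⟨⟨h1.mul_simple_le_mul_simple (Or.inr hx),
            h2.mul_simple_le_mul_simple (Or.inr hw), by omega⟩,
            fun e => (isLow_mul_simple_iff x i).1 (by rwa [e]) hx⟩
        · have h4 := h1.mul_simple_le hx
          obtain rfl := h.eq_of_twistedLength_le h4 (by omega)
          exact Or.inl ⟨rfl, h2, hw.pathLE, by omega⟩
      · rintro (⟨rfl, h1, h2, h3⟩ | ⟨⟨h1, h2, h3⟩, h4⟩)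
        · exact ⟨hv.pathLE, h1, by omega⟩
        · by_cases hx : cs.IsLow J (x * cs.simple i) i
          · have h5 := h2.le_mul_simple hx
            rw [simple_mul_simple_cancel_right] at h5
            exact absurd (h.eq_of_twistedLength_le h5 (by omega)) h4
          · have h5 := h1.mul_simple_le_mul_simple (Or.inl fun e => (isLow_mul_simple_iff v i).1 e hv)
            have h6 := h2.mul_simple_le_mul_simple (Or.inl hx)
            have rx := h.twistedLength_of_not_isLow hx
            simp only [simple_mul_simple_cancel_right] at h5 h6 rx
            exact ⟨h5, h6, by omega⟩
    · rintro ⟨h1, h2, h3⟩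
      rw [simple_mul_simple_cancel_right] at h3
      omega
  · have rv := h.twistedLength_of_isLow hv
    have rw' := h.twistedLength_of_not_isLow hw
    refine ⟨v * cs.simple i, w * cs.simple i, ?_, fun x => ⟨?_, ?_⟩⟩
    · intro e
      exact hw ((mul_right_cancel e) ▸ hv)
    · rintro ⟨h1, h2, h3⟩
      by_cases hx : cs.IsLow J x i
      · exact Or.inr (h.eq_of_twistedLength_le (h2.le_mul_simple hx) (by omega))
      · exact Or.inl (h.eq_of_twistedLength_le (h1.mul_simple_le hx) (by omega)).symm
    · rintro (rfl | rfl)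
      · exact ⟨hv.pathLE, hvw.mul_simple_le hw, by omega⟩
      · exact ⟨hvw.le_mul_simple hv, pathLE_of_not_isLow hw, by omega⟩
  · tauto
  · have rv := h.twistedLength_of_not_isLow hv
    have rw' := h.twistedLength_of_not_isLow hw
    refine exists_pair_of_swap (cs.simple i) v (w * cs.simple i) (fun x => ?_) ?_
      (hQ' (by simp [hv, hw]) (by omega))
    · constructor
      · rintro ⟨h1, h2, h3⟩
        by_cases hx : cs.IsLow J x i
        · obtain rfl := h.eq_of_twistedLength_le (h2.le_mul_simple hx) (by omega)
          exact Or.inl ⟨rfl, pathLE_of_not_isLow hv, h1, by omega⟩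
        · have rx := h.twistedLength_of_not_isLow hx
          exact Or.inr ⟨⟨h1.mul_simple_le_mul_simple (Or.inl hv),
            h2.mul_simple_le_mul_simple (Or.inl hx), by omega⟩,
            fun e => hv (by rw [← e]; exact hhigh hx)⟩
      · rintro (⟨rfl, h1, h2, h3⟩ | ⟨⟨h1, h2, h3⟩, h4⟩)
        · exact ⟨h2, pathLE_of_not_isLow hw, by omega⟩
        · by_cases hx : cs.IsLow J (x * cs.simple i) i
          · have h5 := h1.mul_simple_le_mul_simple (Or.inr hx)
            have h6 := h2.mul_simple_le_mul_simple (Or.inr (hhigh hw))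
            have rx := h.twistedLength_of_isLow hx
            simp only [simple_mul_simple_cancel_right] at h5 h6 rx
            exact ⟨h5, h6, by omega⟩
          · have h5 := h1.le_mul_simple (hhigh hv)
            have rx := h.twistedLength_of_not_isLow hx
            rw [simple_mul_simple_cancel_right] at h5 rx
            exact absurd (h.eq_of_twistedLength_le h5 (by omega)).symm
              (fun e => h4 (by rw [e, simple_mul_simple_cancel_right]))
    · rintro ⟨h1, h2, h3⟩
      rw [simple_mul_simple_cancel_right] at h3
      omega

end IsParabolicFactorization

end CoxeterSystem

namespace CoxeterSystem

open CoxeterMatrix Polynomial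

variable {B : Type*} {M : CoxeterMatrix B} {W : Type*} [Group W] {cs : CoxeterSystem M W}
variable {J : Set B}

theorem shortens_mul_iff {r t : W} (hr : cs.IsReflection r) (ht : cs.IsReflection t) (x : W) :
    cs.Shortens r (t * x) ↔ (cs.Shortens r t ↔ ¬ cs.Shortens (t * r * t) x) := by
  obtain ⟨c, hc, h1⟩ := cs.exists_geomRep_root t hr
  rw [ht.inv] at h1
  have hr' : cs.IsReflection (t * r * t) := by simpa [ht.inv] using hr.conj t
  rw [shortens_iff _ hr, shortens_iff _ hr, shortens_iff _ hr', mul_inv_rev, ht.inv, geomRep_mul,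
    h1, map_smul, isPos_smul_root _ hr']
  obtain ⟨d, hd, h2⟩ := cs.exists_geomRep_root x⁻¹ hr'
  have hr'' := hr'.conj x⁻¹
  rw [h2, smul_smul, isPos_smul_root _ hr'', isPos_smul_root _ hr'']
  rcases lt_or_gt_of_ne hc with hc | hc <;> rcases lt_or_gt_of_ne hd with hd | hd
  · simp [hc.not_ge, hd.not_ge, (mul_pos_of_neg_of_neg hc hd).le]
  · simp [hc.not_ge, hd.le, (mul_neg_of_neg_of_pos hc hd).not_ge]
  · simp [hc.le, hd.not_ge, (mul_neg_of_pos_of_neg hc hd).not_ge]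
  · simp [hc.le, hd.le, (mul_pos hc hd).le]

theorem IsTwistedReflectionOrder.isLow_iff [LinearOrder W] (ho : cs.IsTwistedReflectionOrder J)
    {t : W} (ht : cs.IsReflection t) {x : W} {i : B} (hne : t ≠ x * cs.simple i * x⁻¹) :
    (cs.IsLow J x i ↔ x * cs.simple i * x⁻¹ < t) ↔
      (cs.IsLow J (t * x) i ↔ t * x * cs.simple i * (t * x)⁻¹ < t) := by
  have hr := (cs.isReflection_simple i).conj x
  set r := x * cs.simple i * x⁻¹ with hrdef
  have e : t * x * cs.simple i * (t * x)⁻¹ = t * r * t := by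
    rw [hrdef, mul_inv_rev, ht.inv]; group
  have hr' : cs.IsReflection (t * r * t) := by simpa [ht.inv] using hr.conj t
  have e2 : t * (t * r * t) * t = r := by simp [mul_assoc, ht.mul_self, ← mul_assoc t t]
  have hne' : t * r * t ≠ t := fun h => hne (by
    rw [← e2, h, ht.mul_self, one_mul])
  have h1 := shortens_mul_iff hr' ht x
  have h2 := ho.shortens_iff _ _ hr' ht hne'
  rw [e2] at h1 h2
  simp only [IsLow, IsUp, e, ← hrdef, hr, hr', true_and]
  generalize cs.Shortens (t * r * t) (t * x) = p₁ at *
  generalize cs.Shortens (t * r * t) t = p₂ at *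
  generalize cs.Shortens r x = p₃ at *
  generalize (r ∈ cs.parabolic J) = p₄ at *
  generalize (t * r * t ∈ cs.parabolic J) = p₅ at *
  generalize (r < t) = p₆ at *
  generalize (t * r * t < t) = p₇ at *
  clear * - h1 h2
  by_cases p₃ <;> by_cases p₄ <;> by_cases p₅ <;> by_cases p₆ <;> by_cases p₇ <;> simp_all

section Operators

open Classical in
/-- The polynomial `g` if `P` holds, and zero otherwise. -/
noncomputable def onlyIf (P : Prop) (g : ℤ[X]) : ℤ[X] := if P then g else 0

@[simp]
theorem onlyIf_true (g : ℤ[X]) : onlyIf True g = g := if_pos trivial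

@[simp]
theorem onlyIf_false (g : ℤ[X]) : onlyIf False g = 0 := if_neg id

theorem onlyIf_mul (P : Prop) (f g : ℤ[X]) : onlyIf P f * g = onlyIf P (f * g) := by
  by_cases h : P <;> simp [h]

variable (cs J) (F : Set W)

/-- Prepending the edge with label `t` to the chains counted by `g`. -/
noncomputable def edgeOp (t : W) (g : W → ℤ[X]) (x : W) : ℤ[X] :=
  g x + onlyIf (x ∈ F ∧ t * x ∈ F ∧ cs.IsUp J x t) (X * g (t * x))

/-- The operator describing right multiplication by a simple reflection. -/
noncomputable def moveOp (i : B) (p : W → Prop) (g : W → ℤ[X]) (x : W) : ℤ[X] :=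
  g (x * cs.simple i) -
    onlyIf (cs.IsLow J x i ↔ p (x * cs.simple i * x⁻¹)) (X * g x)

variable {cs J F}

theorem moveOp_edgeOp [LinearOrder W] (ho : cs.IsTwistedReflectionOrder J) {i : B}
    (hF : ∀ x ∈ F, x * cs.simple i ∈ F) {t : W} (ht : cs.IsReflection t) {p : W → Prop}
    (hpt : ¬ p t) (hp : ∀ x ∈ F, x * cs.simple i * x⁻¹ ≠ t →
      (p (x * cs.simple i * x⁻¹) ↔ x * cs.simple i * x⁻¹ < t)) (g : W → ℤ[X]) {x : W}
    (hx : x ∈ F) :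
    cs.moveOp J i p (cs.edgeOp J F t g) x =
      cs.edgeOp J F t (cs.moveOp J i (fun r => p r ∨ r = t) g) x := by
  have hF' : ∀ x, x * cs.simple i ∈ F ↔ x ∈ F := fun x => ⟨fun h => by
    simpa using hF _ h, hF x⟩
  by_cases htx : t = x * cs.simple i * x⁻¹
  · have e1 : t * x = x * cs.simple i := by simp [htx]
    have e2 : t * (x * cs.simple i) = x := by rw [← e1, ← mul_assoc, ht.mul_self, one_mul]
    have e3 : x * (x * cs.simple i)⁻¹ = t := by simp [htx, mul_assoc]
    have e4 := isUp_mul_self_iff (J := J) ht x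
    have e5 : cs.IsLow J x i ↔ cs.IsUp J x t := by rw [IsLow, htx]
    rw [e1] at e4
    simp only [moveOp, edgeOp, e1, e2, e3, hx, hF x hx, true_and, e4, isLow_mul_simple_iff,
      ← e5, ← htx, hpt, false_or, simple_mul_simple_cancel_right]
    by_cases hl : cs.IsLow J x i <;>
      simp only [hl, not_true_eq_false, not_false_eq_true, iff_true, iff_false, onlyIf_true,
        onlyIf_false] <;>
      ring
  · have e1 : t ≠ t * x * cs.simple i * (t * x)⁻¹ := fun h => htx (by
      have h2 : t = t * (x * cs.simple i * x⁻¹) * t := by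
        nth_rw 1 [h]; rw [mul_inv_rev, ht.inv]; group
      have h3 : t * t * t = t * (x * cs.simple i * x⁻¹) * t := by
        rw [ht.mul_self, one_mul]; exact h2
      exact mul_left_cancel (mul_right_cancel h3))
    simp only [moveOp, edgeOp, hF', hx, true_and, isUp_mul_simple_iff htx, ← mul_assoc t x,
      Ne.symm htx, or_false, Ne.symm e1]
    by_cases hu : t * x ∈ F ∧ cs.IsUp J x t
    · have h1 := ho.isLow_iff ht htx
      rw [← hp x hx (Ne.symm htx), ← hp _ hu.1 (Ne.symm e1)] at h1
      simp only [hu, h1, and_self, onlyIf_true]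
      by_cases hl : cs.IsLow J (t * x) i ↔ p (t * x * cs.simple i * (t * x)⁻¹)
      · simp only [hl, onlyIf_true]
        ring
      · simp only [hl, onlyIf_false]
        ring
    · have hu' : ¬(t * x ∈ F ∧ cs.IsUp J x t) := hu
      simp only [hu', onlyIf_false]
      ring_nf

theorem edgeOp_congr {t : W} {g g' : W → ℤ[X]} (hg : ∀ x ∈ F, g x = g' x) {x : W} (hx : x ∈ F) :
    cs.edgeOp J F t g x = cs.edgeOp J F t g' x := by
  rw [edgeOp, edgeOp, hg x hx]
  by_cases h : x ∈ F ∧ t * x ∈ F ∧ cs.IsUp J x t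
  · rw [hg _ h.2.1]
  · simp only [h, onlyIf_false]

theorem moveOp_foldr_edgeOp [LinearOrder W] (ho : cs.IsTwistedReflectionOrder J) {i : B}
    (hF : ∀ x ∈ F, x * cs.simple i ∈ F) {L : List W} (hL : L.Pairwise (· < ·))
    (hrefl : ∀ t ∈ L, cs.IsReflection t)
    (hlt : ∀ x ∈ F, x * cs.simple i * x⁻¹ ∉ L → ∀ t ∈ L, x * cs.simple i * x⁻¹ < t)
    (g : W → ℤ[X]) {x : W} (hx : x ∈ F) :
    cs.moveOp J i (· ∉ L) (L.foldr (cs.edgeOp J F) g) x =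
      L.foldr (cs.edgeOp J F) (cs.moveOp J i (fun _ => True) g) x := by
  induction L generalizing x with
  | nil => simp
  | cons t L ih =>
    rw [List.pairwise_cons] at hL
    rw [List.forall_mem_cons] at hrefl
    have htL : t ∉ L := fun h => lt_irrefl _ (hL.1 t h)
    rw [List.foldr_cons, List.foldr_cons, moveOp_edgeOp ho hF hrefl.1 (by simp) _ _ hx]
    · apply edgeOp_congr _ hx
      intro y hy
      rw [← ih hL.2 hrefl.2 _ hy]
      · congr 1
        ext r
        simp only [List.mem_cons, not_or]
        by_cases hr : r = t
        · simp [hr, htL]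
        · simp [hr]
      · intro y hy hyL t' ht'
        by_cases hyt : y * cs.simple i * y⁻¹ = t
        · rw [hyt]; exact hL.1 t' ht'
        · exact hlt y hy (by simp [hyt, hyL]) t' (by simp [ht'])
    · intro y hy hne
      refine ⟨fun h => hlt y hy h t (by simp), fun h => ?_⟩
      simp only [List.mem_cons, hne, false_or]
      exact fun h' => lt_asymm h (hL.1 _ h')

end Operators

variable (cs) in
/-- The paths of the twisted Bruhat graph, given by their edge labels. -/
def IsPath (J : Set B) : W → List W → W → Prop
  | x, [], y => x = y
  | x, t :: l, y => cs.IsUp J x t ∧ IsPath J (t * x) l y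

theorem IsPath.pathLE {x y : W} {l : List W} (h : cs.IsPath J x l y) : cs.PathLE J x y := by
  induction l generalizing x with
  | nil => cases h; exact PathLE.refl _
  | cons t l ih => exact h.1.pathLE.trans (ih h.2)

variable (cs) in
open Classical in
/-- The indicator function of `w`. -/
noncomputable def indicator (w x : W) : ℤ[X] := if x = w then 1 else 0

variable (cs) in
/-- The label sequences of the increasing paths with `k` edges. -/
def incPaths [LinearOrder W] (J : Set B) (x y : W) (k : ℕ) : Set (List W) :=
  {l | l.Pairwise (· < ·) ∧ cs.IsPath J x l y ∧ l.length = k}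

open Classical in
theorem coeff_foldr_edgeOp {F : Set W} (hF : ∀ x ∈ F, ∀ z ∈ F, ∀ y, cs.PathLE J x y →
    cs.PathLE J y z → y ∈ F) (L : List W) {x w : W} (hx : x ∈ F) (hw : w ∈ F) (k : ℕ) :
    (L.foldr (cs.edgeOp J F) (indicator w) x).coeff k =
      L.sublists'.countP fun l => cs.IsPath J x l w ∧ l.length = k := by
  induction L generalizing x k with
  | nil =>
    rcases k with - | k
    · by_cases h : x = w <;> simp [IsPath, indicator, h]
    · by_cases h : x = w <;> simp [IsPath, indicator, h, coeff_one]
  | cons t L ih =>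
    rw [List.foldr_cons, edgeOp, coeff_add, ih hx, List.sublists'_cons, List.countP_append,
      List.countP_map, Nat.cast_add]
    congr 1
    by_cases h : x ∈ F ∧ t * x ∈ F ∧ cs.IsUp J x t
    · rw [eq_true h, onlyIf_true]
      rcases k with - | k
      · simp [Function.comp_def]
      · rw [coeff_X_mul, ih h.2.1]
        simp [Function.comp_def, IsPath, h.2.2]
    · rw [eq_false h, onlyIf_false, coeff_zero, eq_comm, Nat.cast_eq_zero, List.countP_eq_zero]
      intro l _ hl
      simp only [Function.comp_apply, decide_eq_true_eq] at hl
      exact h ⟨hx, hF x hx w hw _ hl.1.1.pathLE hl.1.2.pathLE, hl.1.1⟩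

end CoxeterSystem

namespace CoxeterSystem

open CoxeterMatrix Polynomial

variable {B : Type*} {M : CoxeterMatrix B} {W : Type*} [Group W] {cs : CoxeterSystem M W}
variable {J : Set B}

theorem foldr_edgeOp_sub_mul {F : Set W} (L : List W) (a b : W → ℤ[X]) (c : ℤ[X]) (x : W) :
    L.foldr (cs.edgeOp J F) (fun y => a y - c * b y) x =
      L.foldr (cs.edgeOp J F) a x - c * L.foldr (cs.edgeOp J F) b x := by
  induction L generalizing x with
  | nil => rfl
  | cons t L ih =>
    simp only [List.foldr_cons, edgeOp, ih]
    by_cases h : x ∈ F ∧ t * x ∈ F ∧ cs.IsUp J x t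
    · simp only [eq_true h, onlyIf_true]; ring
    · simp only [eq_false h, onlyIf_false]; ring

theorem IsPath.mem_labels {F : Set W} (hF : ∀ x ∈ F, ∀ z ∈ F, ∀ y, cs.PathLE J x y →
    cs.PathLE J y z → y ∈ F) {l : List W} {x w : W} (hx : x ∈ F) (hw : w ∈ F)
    (h : cs.IsPath J x l w) {t : W} (ht : t ∈ l) :
    cs.IsReflection t ∧ ∃ a ∈ F, ∃ b ∈ F, b * a⁻¹ = t := by
  induction l generalizing x with
  | nil => simp at ht
  | cons r l ih =>
    have hr : r * x ∈ F := hF x hx w hw _ h.1.pathLE h.2.pathLE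
    rcases List.mem_cons.1 ht with rfl | ht
    · exact ⟨h.1.1, x, hx, t * x, hr, by simp⟩
    · exact ih hr h.2 ht

section Counting

variable [LinearOrder W]

open Classical in
/-- The reflections occurring as labels of edges between elements of the finite set `F`. -/
noncomputable def labels (cs : CoxeterSystem M W) (F : Finset W) : List W :=
  (((F ×ˢ F).image fun p => p.2 * p.1⁻¹).filter cs.IsReflection).sort

theorem mem_labels {F : Finset W} {t : W} :
    t ∈ cs.labels F ↔ cs.IsReflection t ∧ ∃ a ∈ F, ∃ b ∈ F, b * a⁻¹ = t := by
  simp [labels]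
  tauto

theorem pairwise_labels (F : Finset W) : (cs.labels F).Pairwise (· < ·) :=
  (Finset.sortedLT_sort _).pairwise

/-- The generating polynomial of the increasing paths from `x` to `w` inside `F`. -/
noncomputable def pathPoly (cs : CoxeterSystem M W) (J : Set B) (F : Finset W) (w x : W) : ℤ[X] :=
  (cs.labels F).foldr (cs.edgeOp J F) (indicator w) x

theorem coeff_pathPoly {F : Finset W} (hF : ∀ x ∈ F, ∀ z ∈ F, ∀ y, cs.PathLE J x y →
    cs.PathLE J y z → y ∈ F) {x w : W} (hx : x ∈ F) (hw : w ∈ F) (k : ℕ) :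
    (cs.pathPoly J F w x).coeff k = (cs.incPaths J x w k).ncard := by
  classical
  have hnd : (cs.labels F).sublists'.Nodup :=
    List.nodup_sublists'.2 ((pairwise_labels F).imp ne_of_lt)
  rw [pathPoly, coeff_foldr_edgeOp hF _ hx hw, List.countP_eq_length_filter,
    ← List.toFinset_card_of_nodup (hnd.filter _), ← Set.ncard_coe_finset]
  congr 2
  ext l
  simp only [List.coe_toFinset, List.mem_filter, List.mem_sublists', decide_eq_true_eq,
    Set.mem_ofPred_eq, incPaths]
  refine and_congr_left fun h => ⟨fun hl => (pairwise_labels F).sublist hl, fun hl => ?_⟩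
  refine List.sublist_of_subperm_of_pairwise (r := (· < ·)) ?_ hl (pairwise_labels F)
  refine List.subperm_of_subset (hl.imp ne_of_lt) fun t ht => ?_
  exact mem_labels.2 (h.1.mem_labels hF hx hw ht)

theorem pathPoly_mul_simple (ho : cs.IsTwistedReflectionOrder J) {F : Finset W} {i : B}
    (hF : ∀ x ∈ F, x * cs.simple i ∈ F) {x : W} (hx : x ∈ F) (w : W) :
    cs.pathPoly J F w (x * cs.simple i) - onlyIf (¬ cs.IsLow J x i) (X * cs.pathPoly J F w x) =
      cs.pathPoly J F (w * cs.simple i) x - onlyIf (cs.IsLow J w i) (X * cs.pathPoly J F w x) := by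
  have hmem : ∀ x ∈ F, x * cs.simple i * x⁻¹ ∈ cs.labels F := fun x hx =>
    mem_labels.2 ⟨(cs.isReflection_simple i).conj x, x, hx, _, hF x hx, rfl⟩
  have h1 := moveOp_foldr_edgeOp (F := (F : Set W)) ho hF (pairwise_labels F)
    (fun t ht => (mem_labels.1 ht).1) (fun x hx h => absurd (hmem x hx) h) (indicator w) hx
  have h2 : cs.moveOp J i (fun _ => True) (indicator w) =
      fun y => indicator (w * cs.simple i) y - onlyIf (cs.IsLow J w i) X * indicator w y := by
    ext1 y
    have h3 : y * cs.simple i = w ↔ y = w * cs.simple i := by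
      constructor <;> rintro rfl <;> simp
    simp only [moveOp, indicator, iff_true, h3]
    by_cases hy : y = w
    · by_cases hl : cs.IsLow J w i <;> simp [hy, hl]
    · by_cases hl : cs.IsLow J w i <;> by_cases hl' : cs.IsLow J y i <;> simp [hy, hl, hl']
  rw [h2, foldr_edgeOp_sub_mul] at h1
  simp only [moveOp, hmem x hx, not_true_eq_false, iff_false] at h1
  rwa [onlyIf_mul] at h1

end Counting

namespace IsParabolicFactorization

variable {wJ Jw : W → W} (h : cs.IsParabolicFactorization J wJ Jw)
include h

theorem twistedLength_add_length_le {x y : W} {l : List W} (hl : cs.IsPath J x l y) :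
    cs.twistedLength wJ Jw x + l.length ≤ cs.twistedLength wJ Jw y := by
  induction l generalizing x with
  | nil => cases hl; simp
  | cons t l ih =>
    have h1 := h.twistedLength_lt_of_isUp hl.1
    have h2 := ih hl.2
    push_cast [List.length_cons]
    omega

variable [LinearOrder W] (ho : cs.IsTwistedReflectionOrder J)
include ho

theorem exists_pathPoly {v w : W} (hvw : cs.PathLE J v w) (i : B) :
    ∃ P : W → W → ℤ[X], ∀ x, x = v ∨ x = v * cs.simple i → ∀ y, y = w ∨ y = w * cs.simple i →
      (∀ k, (P y x).coeff k = (cs.incPaths J x y k).ncard) ∧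
      P y (x * cs.simple i) - onlyIf (¬ cs.IsLow J x i) (X * P y x) =
        P (y * cs.simple i) x - onlyIf (cs.IsLow J y i) (X * P y x) := by
  have hfin := h.finite_interval (cs.lower J v i) (cs.upper J w i)
  set F := hfin.toFinset with hFdef
  have hmem : ∀ x, x ∈ F ↔ cs.PathLE J (cs.lower J v i) x ∧ cs.PathLE J x (cs.upper J w i) :=
    fun x => by simp [hFdef]
  have hF : ∀ x ∈ F, ∀ z ∈ F, ∀ y, cs.PathLE J x y → cs.PathLE J y z → y ∈ F :=
    fun x hx z hz y h1 h2 => (hmem y).2 ⟨((hmem x).1 hx).1.trans h1, h2.trans ((hmem z).1 hz).2⟩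
  have hlow : cs.IsLow J (cs.lower J v i) i := by
    rw [lower]
    split_ifs with h
    · exact h
    · rwa [isLow_mul_simple_iff]
  have hupp : ¬ cs.IsLow J (cs.upper J w i) i := by
    rw [upper]
    split_ifs with h
    · rwa [isLow_mul_simple_iff, not_not]
    · exact h
  have hFs : ∀ x ∈ F, x * cs.simple i ∈ F := fun x hx =>
    (hmem _).2 ⟨((hmem x).1 hx).1.le_mul_simple hlow, ((hmem x).1 hx).2.mul_simple_le hupp⟩
  have hv : v ∈ F := (hmem _).2 ⟨(PathLE.refl v).lower_le i, hvw.le_upper i⟩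
  have hw : w ∈ F := (hmem _).2 ⟨hvw.lower_le i, (PathLE.refl w).le_upper i⟩
  refine ⟨cs.pathPoly J F, fun x hx y hy => ?_⟩
  have hx' : x ∈ F := by
    rcases hx with rfl | rfl
    · exact hv
    · exact hFs _ hv
  have hy' : y ∈ F := by
    rcases hy with rfl | rfl
    · exact hw
    · exact hFs _ hw
  exact ⟨coeff_pathPoly hF hx' hy', pathPoly_mul_simple ho hFs hx' y⟩

theorem ncard_incPaths {v w : W} (hvw : cs.PathLE J v w) :
    (cs.incPaths J v w (cs.twistedLength wJ Jw w - cs.twistedLength wJ Jw v).toNat).ncard = 1 := by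
  refine h.interval_induction (Q := fun v w => (cs.incPaths J v w (cs.twistedLength wJ Jw w -
    cs.twistedLength wJ Jw v).toNat).ncard = 1) (fun v => ?_) (fun v w i hvw hi hQ hQ' => ?_) hvw
  · rw [Set.ncard_eq_one]
    refine ⟨[], ?_⟩
    ext l
    simp only [incPaths, sub_self, Int.toNat_zero, List.length_eq_zero_iff, Set.mem_ofPred_eq,
      Set.mem_singleton_iff]
    refine ⟨fun h => h.2.2, ?_⟩
    rintro rfl
    simp [IsPath]
  · obtain ⟨P, hP⟩ := h.exists_pathPoly ho hvw i
    by_cases hv : cs.IsLow J v i <;> by_cases hw : cs.IsLow J w i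
    · obtain ⟨-, h1⟩ := hP v (Or.inl rfl) (w * cs.simple i) (Or.inr rfl)
      obtain ⟨h2, -⟩ := hP v (Or.inl rfl) w (Or.inl rfl)
      obtain ⟨h3, -⟩ := hP (v * cs.simple i) (Or.inr rfl) (w * cs.simple i) (Or.inr rfl)
      simp only [isLow_mul_simple_iff, hv, hw, not_true_eq_false, onlyIf_false, sub_zero,
        simple_mul_simple_cancel_right] at h1
      have h4 := hQ' (by simp [hv, hw])
      rw [h.twistedLength_of_isLow hv, h.twistedLength_of_isLow hw, add_sub_add_right_eq_sub] at h4
      have h5 := h2 (cs.twistedLength wJ Jw w - cs.twistedLength wJ Jw v).toNat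
      rw [← h1, h3] at h5
      omega
    · obtain ⟨h3, h1⟩ := hP v (Or.inl rfl) (w * cs.simple i) (Or.inr rfl)
      obtain ⟨h2, -⟩ := hP v (Or.inl rfl) w (Or.inl rfl)
      obtain ⟨h4, -⟩ := hP (v * cs.simple i) (Or.inr rfl) (w * cs.simple i) (Or.inr rfl)
      simp only [isLow_mul_simple_iff, hv, hw, not_true_eq_false, onlyIf_false, sub_zero,
        simple_mul_simple_cancel_right, not_false_eq_true, onlyIf_true] at h1
      have hne : v ≠ w := by rintro rfl; exact hw hv
      have hlt : cs.twistedLength wJ Jw v < cs.twistedLength wJ Jw w := by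
        by_contra hle
        exact hne (h.eq_of_twistedLength_le hvw (not_lt.1 hle))
      have hrw := h.twistedLength_of_not_isLow hw
      have hrv := h.twistedLength_of_isLow hv
      have hu := hQ v (w * cs.simple i) (hvw.le_mul_simple hv) (by omega)
      obtain ⟨n, hn⟩ : ∃ n : ℕ, cs.twistedLength wJ Jw w - cs.twistedLength wJ Jw v = n + 1 :=
        ⟨(cs.twistedLength wJ Jw w - cs.twistedLength wJ Jw v - 1).toNat, by omega⟩
      rw [show cs.twistedLength wJ Jw (w * cs.simple i) - cs.twistedLength wJ Jw v = n by omega,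
        Int.toNat_natCast] at hu
      have hz : cs.incPaths J (v * cs.simple i) (w * cs.simple i) (n + 1) = ∅ := by
        refine Set.eq_empty_of_forall_notMem fun l hl => ?_
        have := h.twistedLength_add_length_le hl.2.1
        rw [hl.2.2] at this
        push_cast at this
        omega
      have h5 := congrArg (fun p => p.coeff (n + 1)) h1
      simp only [coeff_sub, coeff_X_mul, h2, h3, h4, hz, hu, Set.ncard_empty] at h5
      rw [hn, show ((n : ℤ) + 1).toNat = n + 1 by omega]
      omega
    · tauto
    · obtain ⟨h3, h1⟩ := hP (v * cs.simple i) (Or.inr rfl) w (Or.inl rfl)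
      obtain ⟨h2, -⟩ := hP v (Or.inl rfl) w (Or.inl rfl)
      obtain ⟨h4, -⟩ := hP (v * cs.simple i) (Or.inr rfl) (w * cs.simple i) (Or.inr rfl)
      simp only [isLow_mul_simple_iff, hv, hw, not_true_eq_false, onlyIf_false, sub_zero,
        simple_mul_simple_cancel_right, not_false_eq_true] at h1
      have h6 := hQ' (by simp [hv, hw])
      have h7 := h.twistedLength_of_not_isLow hv
      have h8 := h.twistedLength_of_not_isLow hw
      rw [show cs.twistedLength wJ Jw (w * cs.simple i) - cs.twistedLength wJ Jw (v * cs.simple i) =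
        cs.twistedLength wJ Jw w - cs.twistedLength wJ Jw v by omega] at h6
      have h5 := h2 (cs.twistedLength wJ Jw w - cs.twistedLength wJ Jw v).toNat
      rw [h1, h4] at h5
      omega

end IsParabolicFactorization

end CoxeterSystem

namespace CoxeterSystem

open CoxeterMatrix

variable {B : Type*} {M : CoxeterMatrix B} {W : Type*} [Group W] {cs : CoxeterSystem M W}
variable {J : Set B}

theorem IsUp.exists_displacement {x t : W} (h : cs.IsUp J x t) :
    ∃ c : ℝ, 0 < c ∧ cs.displacement (t * x) = cs.displacement x + c • cs.twistedRoot J t := by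
  obtain ⟨h0, h1⟩ := cs.coroot_geomRep_ne_zero h.1 x
  have h2 := cs.displacement_reflection_mul h.1 x
  rcases parabolicSign_cases (cs := cs) J t with ⟨hJ, hs⟩ | ⟨hJ, hs⟩
  · refine ⟨-cs.coroot t (cs.geomRep x (0, 1)), ?_, ?_⟩
    · have : ¬ 0 < cs.coroot t (cs.geomRep x (0, 1)) := fun hc => h1.1 hc (h.2.2 hJ)
      rw [neg_pos]
      exact lt_of_le_of_ne (not_lt.1 this) h0
    · rw [h2, twistedRoot, hs]
      module
  · refine ⟨_, h1.2 fun hc => hJ (h.2.1 hc), ?_⟩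
    rw [h2, twistedRoot, hs, one_smul]

/-- The set of vertices of the path with starting point `x` and labels `l`. -/
def verts : W → List W → Set W
  | x, [] => {x}
  | x, t :: l => insert x (verts (t * x) l)

@[simp]
theorem mem_verts_self (x : W) (l : List W) : x ∈ verts x l := by
  cases l <;> simp [verts]

theorem finite_verts (x : W) (l : List W) : (verts x l).Finite := by
  induction l generalizing x with
  | nil => exact Set.finite_singleton x
  | cons t l ih => exact (ih _).insert x

theorem IsPath.mem_verts_end {x w : W} {l : List W} (h : cs.IsPath J x l w) : w ∈ verts x l := by
  induction l generalizing x with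
  | nil => cases h; exact mem_verts_self _ _
  | cons t l ih => exact Or.inr (ih h.2)

theorem IsPath.pathLE_of_mem_verts {x w y : W} {l : List W} (h : cs.IsPath J x l w)
    (hy : y ∈ verts x l) : cs.PathLE J x y ∧ cs.PathLE J y w := by
  induction l generalizing x with
  | nil => cases h; cases hy; exact ⟨PathLE.refl _, PathLE.refl _⟩
  | cons t l ih =>
    rcases hy with rfl | hy
    · exact ⟨PathLE.refl _, h.pathLE⟩
    · exact ⟨h.1.pathLE.trans (ih h.2 hy).1, (ih h.2 hy).2⟩

variable (cs) in
/-- The saturated paths of the twisted Bruhat graph. -/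
structure IsSaturated (J : Set B) (wJ Jw : W → W) (x : W) (l : List W) (w : W) : Prop where
  isPath : cs.IsPath J x l w
  twistedLength_eq : cs.twistedLength wJ Jw w = cs.twistedLength wJ Jw x + l.length

theorem isSaturated_nil {wJ Jw : W → W} {x w : W} : cs.IsSaturated J wJ Jw x [] w ↔ x = w :=
  ⟨fun h => h.1, fun h => ⟨h, by simp [h]⟩⟩

namespace IsParabolicFactorization

variable {wJ Jw : W → W} (h : cs.IsParabolicFactorization J wJ Jw)
include h

theorem isSaturated_cons {x w t : W} {l : List W} :
    cs.IsSaturated J wJ Jw x (t :: l) w ↔ cs.IsUp J x t ∧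
      cs.twistedLength wJ Jw (t * x) = cs.twistedLength wJ Jw x + 1 ∧
        cs.IsSaturated J wJ Jw (t * x) l w := by
  constructor
  · rintro ⟨⟨h1, h2⟩, h3⟩
    have h4 := h.twistedLength_lt_of_isUp h1
    have h5 := h.twistedLength_add_length_le h2
    push_cast [List.length_cons] at h3
    exact ⟨h1, by omega, h2, by omega⟩
  · rintro ⟨h1, h2, h3, h4⟩
    refine ⟨⟨h1, h3⟩, ?_⟩
    push_cast [List.length_cons]
    omega

theorem eq_of_mem_verts {x w y z : W} {l : List W} (hl : cs.IsPath J x l w)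
    (hy : y ∈ verts x l) (hz : z ∈ verts x l)
    (hr : cs.twistedLength wJ Jw y = cs.twistedLength wJ Jw z) : y = z := by
  induction l generalizing x with
  | nil => exact hy.trans hz.symm
  | cons t l ih =>
    have h1 := h.twistedLength_lt_of_isUp hl.1
    rcases hy with rfl | hy <;> rcases hz with rfl | hz
    · rfl
    · have := h.twistedLength_le (hl.2.pathLE_of_mem_verts hz).1
      omega
    · have := h.twistedLength_le (hl.2.pathLE_of_mem_verts hy).1
      omega
    · exact ih hl.2 hy hz

theorem notMem_verts {x w t : W} {l : List W} (ht : cs.IsUp J x t)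
    (hl : cs.IsPath J (t * x) l w) : x ∉ verts (t * x) l := fun hx => by
  have h1 := h.twistedLength_lt_of_isUp ht
  have h2 := h.twistedLength_le (hl.pathLE_of_mem_verts hx).1
  omega

theorem ncard_verts {x w : W} {l : List W} (hl : cs.IsPath J x l w) :
    (verts x l).ncard = l.length + 1 := by
  induction l generalizing x with
  | nil => simp [verts]
  | cons t l ih =>
    rw [verts, Set.ncard_insert_of_notMem (h.notMem_verts hl.1 hl.2) (finite_verts _ _), ih hl.2,
      List.length_cons]

theorem verts_injective {x w : W} {l l' : List W} (hl : cs.IsSaturated J wJ Jw x l w)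
    (hl' : cs.IsSaturated J wJ Jw x l' w) (he : verts x l = verts x l') : l = l' := by
  induction l generalizing x l' with
  | nil =>
    have h1 := hl.2
    rw [hl'.2] at h1
    exact (List.length_eq_zero_iff.1 (by simpa using h1)).symm
  | cons t l ih =>
    rcases l' with - | ⟨t', l'⟩
    · have h1 := hl'.2
      rw [hl.2, List.length_cons, List.length_nil] at h1
      omega
    · have hp := hl.1
      have hp' := hl'.1
      rw [h.isSaturated_cons] at hl hl'
      have h1 : t' * x ∈ verts x (t :: l) := he ▸ Or.inr (mem_verts_self _ _)
      have h2 := h.eq_of_mem_verts hp (Or.inr (mem_verts_self _ _)) h1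
        (hl.2.1.trans hl'.2.1.symm)
      obtain rfl := mul_right_cancel h2
      rw [ih hl.2.2 hl'.2.2]
      have h3 := congrArg (· \ {x}) he
      simpa [verts, h.notMem_verts hp.1 hp.2, h.notMem_verts hp'.1 hp'.2] using h3

variable [LinearOrder W] (ho : cs.IsTwistedReflectionOrder J)
include ho

theorem exists_increasing {x w : W} (hxw : cs.PathLE J x w) :
    ∃ l : List W, l.Pairwise (· < ·) ∧ cs.IsSaturated J wJ Jw x l w := by
  obtain ⟨l, hl⟩ := Set.ncard_eq_one.1 (h.ncard_incPaths ho hxw)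
  have h1 : l ∈ cs.incPaths J x w _ := hl ▸ Set.mem_singleton l
  have h2 := h.twistedLength_le hxw
  exact ⟨l, h1.1, h1.2.1, by rw [h1.2.2]; omega⟩

theorem increasing_unique {x w : W} {l l' : List W} (hi : l.Pairwise (· < ·))
    (hl : cs.IsSaturated J wJ Jw x l w) (hi' : l'.Pairwise (· < ·))
    (hl' : cs.IsSaturated J wJ Jw x l' w) : l = l' := by
  obtain ⟨m, hm⟩ := Set.ncard_eq_one.1 (h.ncard_incPaths ho hl.1.pathLE)
  have h1 : ∀ {l}, l.Pairwise (· < ·) → cs.IsSaturated J wJ Jw x l w → l = m := by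
    intro l hi hl
    have : l ∈ cs.incPaths J x w
        (cs.twistedLength wJ Jw w - cs.twistedLength wJ Jw x).toNat :=
      ⟨hi, hl.1, by have := hl.2; omega⟩
    rwa [hm] at this
  rw [h1 hi hl, h1 hi' hl']

theorem exists_flip {x w t t' : W} (hl : cs.IsSaturated J wJ Jw x [t, t'] w) (ht : t' < t) :
    ∃ p q, p < t ∧ cs.IsSaturated J wJ Jw x [p, q] w := by
  obtain ⟨l, hi, hl'⟩ := h.exists_increasing ho hl.1.pathLE
  have hlen : l.length = 2 := by
    have h1 := hl.2
    rw [hl'.2, add_right_inj] at h1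
    exact_mod_cast h1
  obtain ⟨p, q, rfl⟩ := List.length_eq_two.1 hlen
  have hpq : p < q := by simpa using hi
  refine ⟨p, q, ?_, hl'⟩
  obtain ⟨h1, h2, h3⟩ := hl.1
  obtain ⟨h1', h2', h3'⟩ := hl'.1
  simp only [IsPath] at h3 h3'
  by_contra! hp
  rcases hp.eq_or_lt with rfl | hp
  · rw [← h3', mul_left_inj] at h3
    exact lt_asymm hpq (h3 ▸ ht)
  · obtain ⟨a, ha, ha'⟩ := h1.exists_displacement
    obtain ⟨b, hb, hb'⟩ := h2.exists_displacement
    obtain ⟨c, hc, hc'⟩ := h1'.exists_displacement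
    obtain ⟨d, hd, hd'⟩ := h2'.exists_displacement
    refine ho.not_comb t' t p q h2.1 h1.1 h1'.1 h2'.1 ht hp (hp.trans hpq) a b c d ha hb hc hd ?_
    rw [h3, ha'] at hb'
    rw [h3', hc'] at hd'
    rw [hb', add_assoc, add_assoc] at hd'
    exact add_left_cancel hd'

theorem increasing_head_le {x w t s : W} {l l' : List W} (hi : (t :: l).Pairwise (· < ·))
    (hl : cs.IsSaturated J wJ Jw x (t :: l) w) (hs : cs.IsSaturated J wJ Jw x (s :: l') w) :
    t ≤ s := by
  set A := {r | ∃ l', cs.IsSaturated J wJ Jw x (r :: l') w}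
  have hA : A.Finite := by
    refine ((h.finite_interval x w).preimage (f := (· * x)) (mul_left_injective x).injOn).subset ?_
    rintro r ⟨l', hr⟩
    exact hr.1.pathLE_of_mem_verts (Or.inr (mem_verts_self _ _))
  obtain ⟨r, ⟨⟨l₀, hr⟩, hmin⟩⟩ := hA.exists_minimal ⟨s, l', hs⟩
  have hmin' : ∀ r' ∈ A, r ≤ r' := fun r' hr' => (le_total r r').elim id fun h => hmin hr' h
  suffices htr : t = r from htr ▸ hmin' s ⟨l', hs⟩
  rw [h.isSaturated_cons] at hr
  obtain ⟨m, hmi, hm⟩ := h.exists_increasing ho hr.2.2.1.pathLE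
  have hm' : cs.IsSaturated J wJ Jw x (r :: m) w := h.isSaturated_cons.2 ⟨hr.1, hr.2.1, hm⟩
  suffices hrm : (r :: m).Pairwise (· < ·) from
    (List.cons.inj (h.increasing_unique ho hi hl hrm hm')).1
  rcases m with - | ⟨r', m⟩
  · simp
  · rw [h.isSaturated_cons] at hm
    have hne : r' ≠ r := by
      rintro rfl
      exact (isUp_mul_self_iff hr.1.1 x).1 hm.1 hr.1
    have hlt : r < r' := by
      by_contra hlt
      have hlt' : r' < r := lt_of_le_of_ne (not_lt.1 hlt) hne
      obtain ⟨p, q, hp, hpq⟩ := h.exists_flip ho (w := r' * (r * x))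
        (h.isSaturated_cons.2 ⟨hr.1, hr.2.1, h.isSaturated_cons.2
          ⟨hm.1, hm.2.1, isSaturated_nil.2 rfl⟩⟩) hlt'
      have hpq' := hpq.1.2.2
      simp only [h.isSaturated_cons] at hpq
      refine (hmin' p ⟨q :: m, h.isSaturated_cons.2 ⟨hpq.1, hpq.2.1, h.isSaturated_cons.2
        ⟨hpq.2.2.1, hpq.2.2.2.1, ?_⟩⟩⟩).not_gt hp
      have hpq'' : q * (p * x) = r' * (r * x) := hpq'
      rw [hpq'']
      exact hm.2.2
    have h2 := List.pairwise_cons.1 hmi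
    refine List.pairwise_cons.2 ⟨?_, hmi⟩
    intro z hz
    rcases List.mem_cons.1 hz with rfl | hz
    · exact hlt
    · exact hlt.trans (h2.1 z hz)

theorem exists_descent_or {x w : W} {l : List W} (hl : cs.IsSaturated J wJ Jw x l w)
    {A : Set W} (hA : w ∈ A) (hne : l ≠ []) :
    (∃ l' m, l' < l ∧ cs.IsSaturated J wJ Jw x l' w ∧ m ∈ verts x l ∧ m ∉ verts x l' ∧ m ∉ A ∧
      cs.twistedLength wJ Jw x < cs.twistedLength wJ Jw m ∧ verts x l \ {m} ⊆ verts x l') ∨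
    (∃ t b b' y, l = t :: b' ∧ (t :: b).Pairwise (· < ·) ∧
      cs.IsSaturated J wJ Jw x (t :: b) y ∧ y ∈ A) := by
  induction l generalizing x with
  | nil => exact absurd rfl hne
  | cons t l ih =>
    have hl₀ := hl
    rw [h.isSaturated_cons] at hl
    by_cases htA : t * x ∈ A
    · exact Or.inr ⟨t, [], l, t * x, rfl, by simp, h.isSaturated_cons.2
        ⟨hl.1, hl.2.1, isSaturated_nil.2 rfl⟩, htA⟩
    rcases l with - | ⟨t', l⟩
    · exact absurd (isSaturated_nil.1 hl.2.2 ▸ hA) htA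
    have hl' := h.isSaturated_cons.1 hl.2.2
    have hne : t' ≠ t := by
      rintro rfl
      exact (isUp_mul_self_iff hl.1.1 x).1 hl'.1 hl.1
    rcases lt_or_gt_of_ne hne with hlt | hlt
    · obtain ⟨p, q, hp, hpq⟩ := h.exists_flip ho (w := t' * (t * x))
        (h.isSaturated_cons.2 ⟨hl.1, hl.2.1, h.isSaturated_cons.2
          ⟨hl'.1, hl'.2.1, isSaturated_nil.2 rfl⟩⟩) hlt
      have he : q * (p * x) = t' * (t * x) := hpq.1.2.2
      simp only [h.isSaturated_cons] at hpq
      have hs : cs.IsSaturated J wJ Jw x (p :: q :: l) w := h.isSaturated_cons.2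
        ⟨hpq.1, hpq.2.1, h.isSaturated_cons.2 ⟨hpq.2.2.1, hpq.2.2.2.1, he ▸ hl'.2.2⟩⟩
      refine Or.inl ⟨p :: q :: l, t * x, List.cons_lt_cons_iff.2 (Or.inl hp), hs,
        Or.inr (mem_verts_self _ _), ?_, htA, by omega, ?_⟩
      · intro hm
        have h1 := h.eq_of_mem_verts hs.1 hm (Or.inr (mem_verts_self _ _))
          (hl.2.1.trans hpq.2.1.symm)
        exact hp.ne' (mul_right_cancel h1)
      · rintro y ⟨hy | hy | hy, hy'⟩
        · exact Or.inl hy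
        · exact absurd hy hy'
        · exact Or.inr (Or.inr (he ▸ hy))
    · rcases ih hl.2.2 (by simp) with ⟨l', m, h1, h2, h3, h4, h5, h6, h7⟩ | ⟨r, b, b', y, h1, h2, h3, h4⟩
      · refine Or.inl ⟨t :: l', m, List.cons_lt_cons_iff.2 (Or.inr ⟨rfl, h1⟩),
          h.isSaturated_cons.2 ⟨hl.1, hl.2.1, h2⟩, Or.inr h3, ?_, h5, by omega, ?_⟩
        · rintro (rfl | hm)
          · omega
          · exact h4 hm
        · rintro z ⟨hz | hz, hz'⟩
          · exact Or.inl hz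
          · exact Or.inr (h7 ⟨hz, hz'⟩)
      · obtain ⟨rfl, rfl⟩ := List.cons.inj h1
        refine Or.inr ⟨t, t' :: b, _, y, rfl, ?_, h.isSaturated_cons.2 ⟨hl.1, hl.2.1, h3⟩, h4⟩
        refine List.pairwise_cons.2 ⟨?_, h2⟩
        intro z hz
        rcases List.mem_cons.1 hz with rfl | hz
        · exact hlt
        · exact hlt.trans ((List.pairwise_cons.1 h2).1 z hz)

theorem exists_shelling_step {x w : W} {l₁ l₂ : List W} (hl₁ : cs.IsSaturated J wJ Jw x l₁ w)
    (hl₂ : cs.IsSaturated J wJ Jw x l₂ w) (hlt : l₁ < l₂) :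
    ∃ l' m, l' < l₂ ∧ cs.IsSaturated J wJ Jw x l' w ∧ m ∈ verts x l₂ ∧ m ∉ verts x l' ∧
      m ∉ verts x l₁ ∧ verts x l₂ \ {m} ⊆ verts x l' := by
  induction l₁ generalizing x l₂ with
  | nil =>
    have h1 := hl₂.2
    rw [hl₁.2] at h1
    have h2 : l₂ = [] := List.length_eq_zero_iff.1 (by simpa using h1.symm)
    exact absurd hlt (by simp [h2])
  | cons s l₁ ih =>
    rcases l₂ with - | ⟨t, l₂⟩
    · exact absurd hlt (List.not_lt_nil _)
    have hl₁' := h.isSaturated_cons.1 hl₁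
    rcases List.cons_lt_cons_iff.1 hlt with hst | ⟨rfl, hlt'⟩
    · rcases h.exists_descent_or ho hl₂ (A := verts x (s :: l₁)) hl₁.1.mem_verts_end (by simp) with
        ⟨l', m, h1, h2, h3, h4, h5, h6, h7⟩ | ⟨t', b, b', y, h1, h2, h3, h4⟩
      · exact ⟨l', m, h1, h2, h3, h4, h5, h7⟩
      · obtain ⟨rfl, rfl⟩ := List.cons.inj h1
        have hxy := h3.2
        rw [List.length_cons] at hxy
        rcases h4 with rfl | hy
        · omega
        obtain ⟨a, -, ha⟩ := h.exists_increasing ho (hl₁'.2.2.1.pathLE_of_mem_verts hy).1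
        have hle := h.increasing_head_le ho h2 h3
          (h.isSaturated_cons.2 ⟨hl₁'.1, hl₁'.2.1, ha⟩)
        exact absurd hst hle.not_gt
    · have hl₂' := h.isSaturated_cons.1 hl₂
      obtain ⟨l', m, h1, h2, h3, h4, h5, h6⟩ := ih hl₁'.2.2 hl₂'.2.2 hlt'
      have hmx : m ≠ x := by
        rintro rfl
        exact h.notMem_verts hl₂'.1 hl₂'.2.2.1 h3
      refine ⟨s :: l', m, List.cons_lt_cons_iff.2 (Or.inr ⟨rfl, h1⟩),
        h.isSaturated_cons.2 ⟨hl₁'.1, hl₁'.2.1, h2⟩, Or.inr h3, ?_, ?_, ?_⟩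
      · rintro (hm | hm)
        exacts [hmx hm, h4 hm]
      · rintro (hm | hm)
        exacts [hmx hm, h5 hm]
      · rintro z ⟨hz | hz, hz'⟩
        · exact Or.inl hz
        · exact Or.inr (h6 ⟨hz, hz'⟩)

end IsParabolicFactorization

end CoxeterSystem

namespace CoxeterSystem

open CoxeterMatrix

variable {B : Type*} {M : CoxeterMatrix B} {W : Type*} [Group W] {cs : CoxeterSystem M W}
variable {J : Set B}

theorem mem_intervalIn {v w x : W} : x ∈ intervalIn (cs.PathLE J) Set.univ v w ↔
    cs.PathLE J v x ∧ cs.PathLE J x w :=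
  ⟨fun h => h.2, fun h => ⟨trivial, h⟩⟩

theorem IsPath.isChain_verts {x w : W} {l : List W} (hl : cs.IsPath J x l w) :
    IsChain (cs.PathLE J) (verts x l) := by
  induction l generalizing x with
  | nil => exact Set.pairwise_singleton _ _
  | cons t l ih =>
    exact (ih hl.2).insert fun y hy _ =>
      Or.inl (hl.1.pathLE.trans (hl.2.pathLE_of_mem_verts hy).1)

namespace IsParabolicFactorization

variable {wJ Jw : W → W} (h : cs.IsParabolicFactorization J wJ Jw)
include h

theorem exists_mem_verts {x w : W} {l : List W} (hl : cs.IsSaturated J wJ Jw x l w) {n : ℤ}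
    (hn : cs.twistedLength wJ Jw x ≤ n) (hn' : n ≤ cs.twistedLength wJ Jw w) :
    ∃ y ∈ verts x l, cs.twistedLength wJ Jw y = n := by
  induction l generalizing x with
  | nil =>
    obtain rfl := isSaturated_nil.1 hl
    exact ⟨x, mem_verts_self _ _, le_antisymm hn hn'⟩
  | cons t l ih =>
    rw [h.isSaturated_cons] at hl
    rcases hn.eq_or_lt with rfl | hn
    · exact ⟨x, mem_verts_self _ _, rfl⟩
    · obtain ⟨y, hy, hy'⟩ := ih hl.2.2 (by omega)
      exact ⟨y, Or.inr hy, hy'⟩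

theorem maxChainIn_verts {v w : W} {l : List W} (hl : cs.IsSaturated J wJ Jw v l w) :
    MaxChainIn (cs.PathLE J) (intervalIn (cs.PathLE J) Set.univ v w) (verts v l) := by
  refine ⟨⟨fun x hx => mem_intervalIn.2 (hl.1.pathLE_of_mem_verts hx), hl.1.isChain_verts⟩, ?_⟩
  intro c hc hlc
  refine hlc.antisymm fun z hz => ?_
  have hz' := mem_intervalIn.1 (hc.1 hz)
  obtain ⟨y, hy, hyz⟩ := h.exists_mem_verts hl (h.twistedLength_le hz'.1) (h.twistedLength_le hz'.2)
  by_cases hne : z = y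
  · exact hne ▸ hy
  · rcases hc.2 hz (hlc hy) hne with h1 | h1
    · exact absurd (h.eq_of_twistedLength_le h1 hyz.le) hne
    · exact absurd (h.eq_of_twistedLength_le h1 hyz.ge).symm hne

omit h in
theorem mem_of_maxChainIn {v w z : W} {c : Set W}
    (hc : MaxChainIn (cs.PathLE J) (intervalIn (cs.PathLE J) Set.univ v w) c)
    (hvz : cs.PathLE J v z) (hzw : cs.PathLE J z w)
    (hz : ∀ y ∈ c, cs.PathLE J z y ∨ cs.PathLE J y z) : z ∈ c := by
  rw [hc.2 (insert z c) ⟨Set.insert_subset (mem_intervalIn.2 ⟨hvz, hzw⟩) hc.1.1,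
    hc.1.2.insert fun y hy _ => hz y hy⟩ (Set.subset_insert _ _)]
  exact Set.mem_insert _ _

theorem exists_eq_verts {v w : W} (hvw : cs.PathLE J v w) {c : Set W}
    (hc : MaxChainIn (cs.PathLE J) (intervalIn (cs.PathLE J) Set.univ v w) c) :
    ∃ l, cs.IsSaturated J wJ Jw v l w ∧ c = verts v l := by
  induction hn : (cs.twistedLength wJ Jw w - cs.twistedLength wJ Jw v).toNat
    generalizing v c with
  | zero =>
    obtain rfl := h.eq_of_twistedLength_le hvw (by omega)
    refine ⟨[], isSaturated_nil.2 rfl, Set.Subset.antisymm (fun x hx => ?_) fun x hx => ?_⟩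
    · have := mem_intervalIn.1 (hc.1.1 hx)
      exact h.pathLE_antisymm this.2 this.1
    · obtain rfl : x = v := hx
      exact mem_of_maxChainIn hc hvw hvw fun y hy => Or.inl (mem_intervalIn.1 (hc.1.1 hy)).1
  | succ n ih =>
    have hvc : v ∈ c := mem_of_maxChainIn hc (PathLE.refl _) hvw fun y hy =>
      Or.inl (mem_intervalIn.1 (hc.1.1 hy)).1
    have hwc : w ∈ c := mem_of_maxChainIn hc hvw (PathLE.refl _) fun y hy =>
      Or.inr (mem_intervalIn.1 (hc.1.1 hy)).2
    have hne : w ≠ v := by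
      rintro rfl
      simp at hn
    have hfin : (c \ {v}).Finite := (h.finite_interval v w).subset fun x hx =>
      mem_intervalIn.1 (hc.1.1 hx.1)
    obtain ⟨a, ⟨hac, hav⟩, hmin⟩ := Set.exists_min_image (c \ {v}) (cs.twistedLength wJ Jw) hfin
      ⟨w, hwc, hne⟩
    have ha := mem_intervalIn.1 (hc.1.1 hac)
    have hmin' : ∀ y ∈ c, y ≠ v → cs.PathLE J a y := by
      intro y hy hyv
      by_cases hya : a = y
      · exact hya ▸ PathLE.refl _
      rcases hc.1.2 hac hy hya with h1 | h1
      · exact h1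
      · exact absurd (h.eq_of_twistedLength_le h1 (hmin y ⟨hy, hyv⟩)).symm hya
    obtain ⟨t, ht, hta, hr⟩ := h.exists_cover ha.1 (Ne.symm hav)
    have htv : t * v ≠ v := fun he => by
      rw [he] at hr
      omega
    have htc : t * v ∈ c := mem_of_maxChainIn hc ht.pathLE (hta.trans ha.2) fun y hy => by
      by_cases hyv : y = v
      · exact Or.inr (hyv ▸ ht.pathLE)
      · exact Or.inl (hta.trans (hmin' y hy hyv))
    obtain rfl : a = t * v := h.pathLE_antisymm (hmin' _ htc htv) hta
    have hc' : MaxChainIn (cs.PathLE J) (intervalIn (cs.PathLE J) Set.univ (t * v) w)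
        (c \ {v}) := by
      refine ⟨⟨fun y hy => mem_intervalIn.2 ⟨hmin' y hy.1 hy.2, (mem_intervalIn.1 (hc.1.1 hy.1)).2⟩,
        hc.1.2.mono Set.sdiff_subset⟩, fun c' hc' hcc' => ?_⟩
      have hle : ∀ y ∈ c', cs.PathLE J v y := fun y hy =>
        ht.pathLE.trans (mem_intervalIn.1 (hc'.1 hy)).1
      have hv : v ∉ c' := fun hv => htv
        (h.pathLE_antisymm (mem_intervalIn.1 (hc'.1 hv)).1 ht.pathLE)
      rw [hc.2 (insert v c') ⟨Set.insert_subset (mem_intervalIn.2 ⟨PathLE.refl _, hvw⟩)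
        fun y hy => mem_intervalIn.2 ⟨hle y hy, (mem_intervalIn.1 (hc'.1 hy)).2⟩,
        hc'.2.insert fun y hy _ => Or.inl (hle y hy)⟩ (by rwa [← Set.sdiff_singleton_subset_iff])]
      simp [hv]
    obtain ⟨l, hl, hcl⟩ := ih ha.2 hc' (by omega)
    refine ⟨t :: l, h.isSaturated_cons.2 ⟨ht, hr, hl⟩, ?_⟩
    rw [verts, ← hcl, Set.insert_sdiff_singleton, Set.insert_eq_of_mem hvc]

theorem ncard_of_maxChainIn {v w : W} (hvw : cs.PathLE J v w) {c : Set W}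
    (hc : MaxChainIn (cs.PathLE J) (intervalIn (cs.PathLE J) Set.univ v w) c) :
    (c.ncard : ℤ) = cs.twistedLength wJ Jw w - cs.twistedLength wJ Jw v + 1 := by
  obtain ⟨l, hl, rfl⟩ := h.exists_eq_verts hvw hc
  rw [h.ncard_verts hl.1, hl.2]
  push_cast
  ring

theorem thinIn : ThinIn (cs.PathLE J) Set.univ := by
  intro v _ w _ hvw hc
  obtain ⟨_, ho⟩ := cs.exists_isTwistedReflectionOrder J
  obtain ⟨l, -, hl⟩ := h.exists_increasing ho hvw
  have h1 := h.ncard_of_maxChainIn hvw (h.maxChainIn_verts hl)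
  rw [hc _ (h.maxChainIn_verts hl)] at h1
  obtain ⟨p, q, hpq, hp⟩ := h.exists_pair hvw (by push_cast at h1; omega)
  have h2 := (hp p).2 (Or.inl rfl)
  have h3 := (hp q).2 (Or.inr rfl)
  push_cast at h1
  have he : intervalIn (cs.PathLE J) Set.univ v w = ({v, p, q, w} : Set W) := by
    ext x
    simp only [mem_intervalIn, Set.mem_insert_iff, Set.mem_singleton_iff]
    constructor
    · rintro ⟨hvx, hxw⟩
      have h4 := h.twistedLength_le hvx
      have h5 := h.twistedLength_le hxw
      by_cases h6 : cs.twistedLength wJ Jw x ≤ cs.twistedLength wJ Jw v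
      · exact Or.inl (h.eq_of_twistedLength_le hvx h6).symm
      by_cases h7 : cs.twistedLength wJ Jw w ≤ cs.twistedLength wJ Jw x
      · exact Or.inr (Or.inr (Or.inr (h.eq_of_twistedLength_le hxw h7)))
      · have := (hp x).1 ⟨hvx, hxw, by omega⟩
        tauto
    · rintro (rfl | rfl | rfl | rfl)
      · exact ⟨PathLE.refl _, hvw⟩
      · exact ⟨h2.1, h2.2.1⟩
      · exact ⟨h3.1, h3.2.1⟩
      · exact ⟨hvw, PathLE.refl _⟩
  have hne : ∀ {x y : W}, cs.twistedLength wJ Jw x < cs.twistedLength wJ Jw y → x ≠ y := by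
    rintro x y hxy rfl
    exact lt_irrefl _ hxy
  have hvp : v ≠ p := hne (by omega)
  have hvq : v ≠ q := hne (by omega)
  have hvw' : v ≠ w := hne (by omega)
  have hpw : p ≠ w := hne (by omega)
  have hqw : q ≠ w := hne (by omega)
  rw [he, Set.ncard_insert_of_notMem (by simp [*]), Set.ncard_insert_of_notMem (by simp [*]),
    Set.ncard_pair hqw]

theorem shellableIn {v w : W} (hvw : cs.PathLE J v w) :
    ShellableIn (cs.PathLE J) (intervalIn (cs.PathLE J) Set.univ v w) := by
  obtain ⟨_, ho⟩ := cs.exists_isTwistedReflectionOrder J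
  have hfin : {l | cs.IsSaturated J wJ Jw v l w}.Finite := by
    refine Set.Finite.of_finite_image (f := verts v)
      ((h.finite_interval v w).finite_subsets.subset ?_)
      fun l hl l' hl' he => h.verts_injective hl hl' he
    rintro _ ⟨l, hl, rfl⟩ x hx
    exact hl.1.pathLE_of_mem_verts hx
  set D := hfin.toFinset
  have hD : ∀ l, l ∈ D ↔ cs.IsSaturated J wJ Jw v l w := fun l => hfin.mem_toFinset
  set e := D.orderEmbOfFin rfl
  have he : ∀ i, cs.IsSaturated J wJ Jw v (e i) w := fun i =>
    (hD _).1 (D.orderEmbOfFin_mem rfl i)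
  have he' : ∀ l, cs.IsSaturated J wJ Jw v l w → ∃ i, e i = l := fun l hl => by
    have : l ∈ Set.range e := by
      rw [Finset.range_orderEmbOfFin]
      exact (hD l).2 hl
    exact this
  refine ⟨D.card, fun i => verts v (e i), ?_, fun i => h.maxChainIn_verts (he i), ?_, ?_⟩
  · intro i j hij
    exact e.injective (h.verts_injective (he i) (he j) hij)
  · intro d hd
    obtain ⟨l, hl, rfl⟩ := h.exists_eq_verts hvw hd
    obtain ⟨i, rfl⟩ := he' l hl
    exact ⟨i, rfl⟩
  · intro i j hij
    obtain ⟨l, m, hlt, hl, hm, hml, hmi, hsub⟩ :=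
      h.exists_shelling_step ho (he i) (he j) (e.lt_iff_lt.2 hij)
    obtain ⟨k, rfl⟩ := he' l hl
    refine ⟨k, e.lt_iff_lt.1 hlt, fun x hx => ⟨hsub ⟨hx.2, ?_⟩, hx.2⟩, ?_⟩
    · rintro rfl
      exact hmi hx.1
    · have : verts v (e k) ∩ verts v (e j) = verts v (e j) \ {m} :=
        Set.Subset.antisymm (fun x hx => ⟨hx.2, fun hxm => hml (hxm ▸ hx.1)⟩)
          fun x hx => ⟨hsub hx, hx.1⟩
      rw [this, Set.ncard_sdiff_singleton_of_mem hm]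

end IsParabolicFactorization

end CoxeterSystem

/-- (Dyer) The `J`-twisted Bruhat order `ᴶ≤` on a Coxeter group `W` is a partial order;
every maximal chain in a closed interval `[v, w]` of `(W, ᴶ≤)` has length
`ᴶℓ(w) − ᴶℓ(v)` where `ᴶℓ(w) = ℓ(ᴶw) − ℓ(w_J)` (so every closed interval is graded);
every closed interval of `(W, ᴶ≤)` is thin; and every closed interval of `(W, ᴶ≤)` is
shellable. -/
theorem twisted_bruhat_order_graded_thin_shellable
    {B : Type*} {M : CoxeterMatrix B} {W : Type*} [Group W] (cs : CoxeterSystem M W)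
    (J : Set B) (wJ Jw : W → W)
    (hmem : ∀ w : W, wJ w ∈ Subgroup.closure (cs.simple '' J))
    (hmin : ∀ w : W, ∀ i ∈ J, cs.length (cs.simple i * Jw w) > cs.length (Jw w))
    (hfac : ∀ w : W, w = wJ w * Jw w)
    (hlen : ∀ w : W, cs.length w = cs.length (wJ w) + cs.length (Jw w))
    (huniq : ∀ w a b : W, a ∈ Subgroup.closure (cs.simple '' J) →
      (∀ i ∈ J, cs.length (cs.simple i * b) > cs.length b) → w = a * b →
      a = wJ w ∧ b = Jw w) :
    (∀ w : W, twistedLE cs J wJ Jw w w) ∧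
    (∀ u v w : W, twistedLE cs J wJ Jw u v → twistedLE cs J wJ Jw v w →
      twistedLE cs J wJ Jw u w) ∧
    (∀ v w : W, twistedLE cs J wJ Jw v w → twistedLE cs J wJ Jw w v → v = w) ∧
    (∀ v w : W, twistedLE cs J wJ Jw v w →
      ∀ c : Set W,
        MaxChainIn (twistedLE cs J wJ Jw)
          (intervalIn (twistedLE cs J wJ Jw) Set.univ v w) c →
        (c.ncard : ℤ) =
          (((cs.length (Jw w) : ℤ) - (cs.length (wJ w) : ℤ)) -
            ((cs.length (Jw v) : ℤ) - (cs.length (wJ v) : ℤ))) + 1) ∧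
    ThinIn (twistedLE cs J wJ Jw) Set.univ ∧
    (∀ v w : W, twistedLE cs J wJ Jw v w →
      ShellableIn (twistedLE cs J wJ Jw)
        (intervalIn (twistedLE cs J wJ Jw) Set.univ v w)) := by
  have h : cs.IsParabolicFactorization J wJ Jw := ⟨hmem, hmin, hfac, hlen, huniq⟩
  have he : twistedLE cs J wJ Jw = cs.PathLE J :=
    funext₂ fun v w => propext h.twistedLE_iff_pathLE
  rw [he]
  exact ⟨CoxeterSystem.PathLE.refl, fun _ _ _ => CoxeterSystem.PathLE.trans,
    fun _ _ => h.pathLE_antisymm, fun _ _ hvw _ => h.ncard_of_maxChainIn hvw,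
    h.thinIn, fun _ _ => h.shellableIn⟩
end
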